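/- Let ν ∈ ℕ, H₁,…,H_ν ∈ ℝ, and let γ₁,…,γ_ν ∈ 𝕋 be distinct. Let f(x) = (Σ_{i=1}^{ν} H_i)·(ι(x) − 1/2) + Σ_{i=1}^{ν} H_i·(𝟙_{[0,γ_i)}(x) − ι(γ_i)). Then for Haar-almost every α ∈ 𝕋 and every x₀ ∈ 𝕋 there exists a strictly increasing sequence (n_ℓ)_{ℓ∈ℕ} of positive integers such that: (i) (Σ_{i=1}^{n_ℓ} a_i)/a_{n_ℓ+1} → 0 as ℓ → ∞; (ii) the limits x̄₀ = lim_{ℓ→∞} q_{n_ℓ}·x₀ and γ̄_i = lim_{ℓ→∞} q_{n_ℓ}·γ_i (i = 1,…,ν) exist in 𝕋, with γ̄_i ≠ γ̄₁ for all i = 2,…,ν, and γ̄₁ ≠ 0 whenever γ₁ ≠ 0; and (iii) sup_{c∈[0,1]} | S_{⌊c·a_{n_ℓ+1}⌋·q_{n_ℓ}}(f,α,x₀)/a_{n_ℓ+1} − [ (Σ_{i=1}^{ν} H_i)·(∫₀^c ι(y + x̄₀) dy − c/2) + Σ_{i=1}^{ν} H_i·(∫₀^c 𝟙_{[0,γ̄_i]}(y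 + x̄₀) dy − c·ι(γ̄_i)) ] | → 0 as ℓ → ∞. -/

import Mathlib

open MeasureTheory Filter Set Topology

noncomputable def toCircle (x : ℝ) : UnitAddCircle := x

/-- The canonical embedding `ι : 𝕋 → [0,1) ⊆ ℝ`. -/
noncomputable def iota (x : UnitAddCircle) : ℝ := (AddCircle.equivIco 1 0 x : ℝ)

/-- The Birkhoff sum `S_N(f, α, x₀) = ∑_{k=0}^{N-1} f(x₀ + kα)`. -/
noncomputable def birkhoff (f : UnitAddCircle → ℝ) (α x₀ : UnitAddCircle) (N : ℕ) : ℝ :=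
  ∑ k ∈ Finset.range N, f (x₀ + k • α)

/-- Iterates of the Gauss map, starting from the fractional part of `α`. -/
noncomputable def gaussIter (α : ℝ) : ℕ → ℝ
  | 0 => Int.fract α
  | n + 1 => Int.fract (1 / gaussIter α n)

/-- The `k`-th partial quotient `a_k(α)` (for `k ≥ 1`) of the continued fraction
expansion of `α`. -/
noncomputable def cfA (α : ℝ) (k : ℕ) : ℕ := ⌊1 / gaussIter α (k - 1)⌋₊

/-- The denominators `q_k(α)` of the convergents of `α`:
`q₀ = 1`, `q₁ = a₁`, `q_{k+1} = a_{k+1} q_k + q_{k-1}`. -/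
noncomputable def cfQ (α : ℝ) : ℕ → ℕ
  | 0 => 1
  | 1 => cfA α 1
  | (k + 2) => cfA α (k + 2) * cfQ α (k + 1) + cfQ α k

/-- The irrational numbers in the open unit interval. -/
def irrUnit : Set ℝ := {x | Irrational x ∧ x ∈ Ioo (0 : ℝ) 1}

/-- Numerators of the convergents with index shifted by one: `cvNum x (n + 1) = p_n`. -/
noncomputable def cvNum (x : ℝ) : ℕ → ℕ
  | 0 => 1
  | 1 => 0
  | (k + 2) => cfA x (k + 1) * cvNum x (k + 1) + cvNum x k

/-- Denominators of the convergents with index shifted by one: `cvDen x (n + 1) = q_n`. -/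
noncomputable def cvDen (x : ℝ) : ℕ → ℕ
  | 0 => 0
  | 1 => 1
  | (k + 2) => cfA x (k + 1) * cvDen x (k + 1) + cvDen x k

lemma cfQ_eq_cvDen (x : ℝ) : ∀ n, cfQ x n = cvDen x (n + 1)
  | 0 => rfl
  | 1 => by simp [cfQ, cvDen]
  | n + 2 => by rw [cfQ, cvDen, cfQ_eq_cvDen x n, cfQ_eq_cvDen x (n + 1)]

lemma cfA_succ (x : ℝ) (n : ℕ) : cfA x (n + 1) = ⌊1 / gaussIter x n⌋₊ := by simp [cfA]

lemma gaussIter_mem {x : ℝ} (hx : x ∈ irrUnit) : ∀ n, gaussIter x n ∈ irrUnit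
  | 0 => by
    have : Int.fract x = x := Int.fract_eq_self.2 ⟨hx.2.1.le, hx.2.2⟩
    simpa [gaussIter, this] using hx
  | n + 1 => by
    have h := gaussIter_mem hx n
    have hi : Irrational (Int.fract (1 / gaussIter x n)) := by
      rw [Int.fract, one_div]
      exact (irrational_inv_iff.2 h.1).sub_intCast _
    exact ⟨hi, lt_of_le_of_ne (Int.fract_nonneg _) hi.ne_zero.symm, Int.fract_lt_one _⟩

lemma gaussIter_zero {x : ℝ} (hx : x ∈ irrUnit) : gaussIter x 0 = x :=
  Int.fract_eq_self.2 ⟨hx.2.1.le, hx.2.2⟩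

lemma one_div_gaussIter {x : ℝ} (hx : x ∈ irrUnit) (n : ℕ) :
    1 / gaussIter x n = cfA x (n + 1) + gaussIter x (n + 1) := by
  have h := (gaussIter_mem hx n).2.1
  rw [cfA_succ, gaussIter, natCast_floor_eq_intCast_floor (by positivity), Int.floor_add_fract]

lemma one_le_cfA {x : ℝ} (hx : x ∈ irrUnit) (n : ℕ) : 1 ≤ cfA x (n + 1) := by
  have h := (gaussIter_mem hx n).2
  rw [cfA_succ, Nat.one_le_floor_iff, le_div_iff₀ h.1]
  linarith [h.2]

lemma cvDen_le_succ {x : ℝ} (hx : x ∈ irrUnit) : ∀ n, cvDen x n ≤ cvDen x (n + 1)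
  | 0 => by simp [cvDen]
  | n + 1 => by
    have := one_le_cfA hx n
    rw [cvDen]
    nlinarith

lemma cvDen_pos {x : ℝ} (hx : x ∈ irrUnit) (n : ℕ) : 0 < cvDen x (n + 1) := by
  induction n with
  | zero => simp [cvDen]
  | succ n ih => exact ih.trans_le (cvDen_le_succ hx _)

lemma cvDen_lt_succ {x : ℝ} (hx : x ∈ irrUnit) (n : ℕ) :
    cvDen x (n + 2) < cvDen x (n + 3) := by
  have := one_le_cfA hx (n + 1)
  have := cvDen_pos hx n
  rw [cvDen.eq_def x (n + 3)]
  dsimp only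
  nlinarith

lemma cvDen_strictMono {x : ℝ} (hx : x ∈ irrUnit) : StrictMono fun n => cvDen x (n + 2) :=
  strictMono_nat_of_lt_succ fun n => cvDen_lt_succ hx n

lemma cvNum_mul_cvDen (x : ℝ) : ∀ n, (cvNum x n : ℤ) * cvDen x (n + 1)
    - cvNum x (n + 1) * cvDen x n = (-1) ^ n
  | 0 => by simp [cvNum, cvDen]
  | n + 1 => by
    have := cvNum_mul_cvDen x n
    rw [cvDen, cvNum]
    push_cast
    rw [pow_succ, ← this]
    ring

lemma coprime_cvDen (x : ℝ) (n : ℕ) : (cvDen x n).Coprime (cvDen x (n + 1)) := by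
  rw [← Nat.isCoprime_iff_coprime]
  have h := cvNum_mul_cvDen x n
  have h1 : ((-1 : ℤ) ^ n) * (-1) ^ n = 1 := by rw [← mul_pow]; simp
  refine ⟨-(-1) ^ n * cvNum x (n + 1), (-1) ^ n * cvNum x n, ?_⟩
  linear_combination ((-1 : ℤ) ^ n) * h + h1

lemma mul_cvDen_eq {x : ℝ} (hx : x ∈ irrUnit) : ∀ n,
    x * (cvDen x (n + 1) + gaussIter x n * cvDen x n)
      = cvNum x (n + 1) + gaussIter x n * cvNum x n
  | 0 => by simp [cvNum, cvDen, gaussIter_zero hx]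
  | n + 1 => by
    have h := mul_cvDen_eq hx n
    have ht := (gaussIter_mem hx n).2.1
    have h2 := one_div_gaussIter hx n
    have h3 : gaussIter x (n + 1) = 1 / gaussIter x n - cfA x (n + 1) := by linarith
    rw [cvDen, cvNum, h3]
    push_cast
    field_simp
    linear_combination h

lemma cvDen_add_pos {x : ℝ} (hx : x ∈ irrUnit) (n : ℕ) {t : ℝ} (ht : 0 ≤ t) :
    (0 : ℝ) < cvDen x (n + 1) + t * cvDen x n := by
  have : (0 : ℝ) < cvDen x (n + 1) := by exact_mod_cast cvDen_pos hx n
  positivity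

/-- The signed distance of `q_n x` to the integer `p_n`. -/
lemma cvDen_mul_sub_cvNum {x : ℝ} (hx : x ∈ irrUnit) (n : ℕ) :
    cvDen x (n + 1) * x - cvNum x (n + 1)
      = (-1) ^ n * gaussIter x n / (cvDen x (n + 1) + gaussIter x n * cvDen x n) := by
  have h := mul_cvDen_eq hx n
  have hp := cvDen_add_pos hx n (gaussIter_mem hx n).2.1.le
  have h2 : (cvNum x n : ℝ) * cvDen x (n + 1) - cvNum x (n + 1) * cvDen x n = (-1) ^ n := by
    exact_mod_cast cvNum_mul_cvDen x n
  rw [eq_div_iff hp.ne', ← h2]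
  linear_combination (cvDen x (n + 1) : ℝ) * h

/-- Two numbers share their first `n` partial quotients. -/
noncomputable def digits (n : ℕ) (x : ℝ) : Fin n → ℕ := fun i => cfA x (i + 1)

lemma digits_eq_iff {n : ℕ} {x y : ℝ} :
    digits n x = digits n y ↔ ∀ i < n, cfA x (i + 1) = cfA y (i + 1) := by
  simp only [digits, funext_iff, Fin.forall_iff]

lemma digits_mono {m n : ℕ} (h : m ≤ n) {x y : ℝ} (hxy : digits n x = digits n y) :
    digits m x = digits m y := by
  rw [digits_eq_iff] at *
  exact fun i hi => hxy i (hi.trans_le h)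

lemma cv_congr {x y : ℝ} : ∀ {n : ℕ}, digits n x = digits n y →
    cvDen x (n + 1) = cvDen y (n + 1) ∧ cvNum x (n + 1) = cvNum y (n + 1) ∧
      cvDen x n = cvDen y n ∧ cvNum x n = cvNum y n
  | 0, _ => by simp [cvDen, cvNum]
  | n + 1, h => by
    obtain ⟨h1, h2, h3, h4⟩ := cv_congr (digits_mono n.le_succ h)
    have h5 := digits_eq_iff.1 h n n.lt_succ_self
    refine ⟨?_, ?_, h1, h2⟩
    · rw [cvDen, cvDen, h1, h3, h5]
    · rw [cvNum, cvNum, h2, h4, h5]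

lemma cfA_eq_of_gaussIter_eq {y : ℝ} (hy : y ∈ irrUnit) {n k : ℕ} {t : ℝ}
    (ht : t ∈ Ioo (0 : ℝ) 1) (h : gaussIter y n = 1 / (k + t)) :
    cfA y (n + 1) = k ∧ gaussIter y (n + 1) = t := by
  have h1 := one_div_gaussIter hy n
  have h2 := (gaussIter_mem hy (n + 1)).2
  rw [h, one_div_one_div] at h1
  have h3 : cfA y (n + 1) = k := by
    rw [cfA_succ, h, one_div_one_div, Nat.floor_eq_iff (by
      linarith [ht.1, (Nat.cast_nonneg k : (0:ℝ) ≤ k)])]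
    exact ⟨by linarith [ht.1], by linarith [ht.2]⟩
  refine ⟨h3, ?_⟩
  rw [h3] at h1
  linarith

lemma inv_add_mem {k : ℕ} (hk : 1 ≤ k) {t : ℝ} (ht : t ∈ irrUnit) :
    1 / ((k : ℝ) + t) ∈ irrUnit := by
  have hk' : (1 : ℝ) ≤ k := by exact_mod_cast hk
  have := ht.2.1
  refine ⟨?_, by positivity, ?_⟩
  · rw [one_div]
    exact irrational_inv_iff.2 (ht.1.natCast_add k)
  · rw [div_lt_one (by linarith)]
    linarith

/-- Every `t` occurs as the `n`-th Gauss iterate of a point of a given cylinder. -/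
lemma exists_gaussIter_eq {x : ℝ} (hx : x ∈ irrUnit) : ∀ (n : ℕ) {t : ℝ}, t ∈ irrUnit →
    ∃ y ∈ irrUnit, digits n y = digits n x ∧ gaussIter y n = t ∧
      y = (cvNum x (n + 1) + t * cvNum x n) / (cvDen x (n + 1) + t * cvDen x n)
  | 0, t, ht => ⟨t, ht, Subsingleton.elim _ _, gaussIter_zero ht, by simp [cvNum, cvDen]⟩
  | n + 1, t, ht => by
    have hk := one_le_cfA hx n
    obtain ⟨y, hy, h1, h2, -⟩ := exists_gaussIter_eq hx n (inv_add_mem hk ht)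
    obtain ⟨h3, h4⟩ := cfA_eq_of_gaussIter_eq hy ht.2 h2
    have h5 : digits (n + 1) y = digits (n + 1) x := by
      rw [digits_eq_iff] at *
      intro i hi
      rcases Nat.lt_succ_iff_lt_or_eq.1 hi with hi | rfl
      · exact h1 i hi
      · exact h3
    refine ⟨y, hy, h5, h4, ?_⟩
    obtain ⟨c1, c2, c3, c4⟩ := cv_congr h5
    rw [eq_div_iff (cvDen_add_pos hx (n + 1) ht.2.1.le).ne', ← c1, ← c2, ← c3, ← c4, ← h4]
    exact mul_cvDen_eq hy (n + 1)

lemma le_cfA_iff {y : ℝ} (hy : y ∈ irrUnit) {n M : ℕ} (hM : 1 ≤ M) :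
    M ≤ cfA y (n + 1) ↔ gaussIter y n < 1 / M := by
  have h := gaussIter_mem hy n
  have hM' : (0 : ℝ) < M := by exact_mod_cast hM
  have hne : gaussIter y n ≠ 1 / M := by
    intro h'
    exact h.1 ⟨1 / M, by rw [h']; push_cast; rfl⟩
  have h0 := h.2.1
  rw [cfA_succ, Nat.le_floor_iff (by positivity), le_one_div hM' h.2.1]
  exact ⟨fun h => lt_of_le_of_ne h hne, le_of_lt⟩

/-- The points of a cylinder whose next partial quotient is at least `M` form an interval. -/
lemma cylinder_eq {x : ℝ} (hx : x ∈ irrUnit) (n : ℕ) {M : ℕ} (hM : 1 ≤ M) :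
    {y | y ∈ irrUnit ∧ digits n y = digits n x ∧ M ≤ cfA y (n + 1)} =
      {y | Irrational y} ∩ Ioo
        (min ((cvNum x (n + 1) : ℝ) / cvDen x (n + 1))
          ((M * cvNum x (n + 1) + cvNum x n) / (M * cvDen x (n + 1) + cvDen x n)))
        (max ((cvNum x (n + 1) : ℝ) / cvDen x (n + 1))
          ((M * cvNum x (n + 1) + cvNum x n) / (M * cvDen x (n + 1) + cvDen x n))) := by
  have hM' : (0 : ℝ) < M := by exact_mod_cast hM
  have hqpos : (0 : ℝ) < cvDen x (n + 1) := by exact_mod_cast cvDen_pos hx n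
  have hdet : (cvNum x n : ℝ) * cvDen x (n + 1) - cvNum x (n + 1) * cvDen x n = (-1) ^ n := by
    exact_mod_cast cvNum_mul_cvDen x n
  set q : ℝ := ((cvDen x (n + 1) : ℕ) : ℝ) with hq
  set q' : ℝ := ((cvDen x n : ℕ) : ℝ) with hq'
  set p : ℝ := ((cvNum x (n + 1) : ℕ) : ℝ) with hp
  set p' : ℝ := ((cvNum x n : ℕ) : ℝ) with hp'
  have hq'0 : 0 ≤ q' := by positivity
  have key : ∀ y t : ℝ, y * (q + t * q') = p + t * p' → 0 < q + t * q' →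
      (y - p / q = (-1) ^ n * t / (q * (q + t * q')) ∧
      y - (M * p + p') / (M * q + q') =
        (-1) ^ n * (M * t - 1) / ((M * q + q') * (q + t * q'))) := by
    intro y t hy hpos
    have hy' : y = (p + t * p') / (q + t * q') := by rw [eq_div_iff hpos.ne', hy]
    constructor
    · rw [hy', ← hdet]; field_simp; ring
    · have : 0 < M * q + q' := by positivity
      rw [hy', ← hdet]; field_simp; ring
  have hMq : 0 < M * q + q' := by positivity
  have hsgn : ((-1 : ℝ) ^ n = 1) ∨ ((-1 : ℝ) ^ n = -1) := neg_one_pow_eq_or ℝ n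
  ext y
  constructor
  · rintro ⟨hy, hd, hMy⟩
    refine ⟨hy.1, ?_⟩
    rw [le_cfA_iff hy hM, lt_div_iff₀ hM'] at hMy
    obtain ⟨c1, c2, c3, c4⟩ := cv_congr hd
    have h1 := mul_cvDen_eq hy n
    rw [c1, c2, c3, c4] at h1
    have ht := (gaussIter_mem hy n).2
    set t := gaussIter y n
    have hpos : 0 < q + t * q' := by have := ht.1; positivity
    obtain ⟨k1, k2⟩ := key y t h1 hpos
    have e1 : 0 < t / (q * (q + t * q')) := by have := ht.1; positivity
    have e2 : 0 < (1 - t * M) / ((M * q + q') * (q + t * q')) := by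
      apply div_pos _ (by positivity)
      linarith
    rw [mem_Ioo, min_lt_iff, lt_max_iff]
    rcases hsgn with hs | hs <;> rw [hs] at k1 k2
    · have e2' : (1 * (M * t - 1)) / ((M * q + q') * (q + t * q'))
        = - ((1 - t * M) / ((M * q + q') * (q + t * q'))) := by ring
      rw [e2'] at k2
      rw [one_mul] at k1
      exact ⟨Or.inl (by linarith), Or.inr (by linarith)⟩
    · have e2' : (-1 * (M * t - 1)) / ((M * q + q') * (q + t * q'))
        = ((1 - t * M) / ((M * q + q') * (q + t * q'))) := by ring
      have e1' : -1 * t / (q * (q + t * q')) = - (t / (q * (q + t * q'))) := by ring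
      rw [e2'] at k2
      rw [e1'] at k1
      exact ⟨Or.inr (by linarith), Or.inl (by linarith)⟩
  · rintro ⟨hirr, hy⟩
    have hirr : Irrational y := hirr
    rw [mem_Ioo, min_lt_iff, lt_max_iff] at hy
    have hne : q' * y - p' ≠ 0 := by
      intro h0
      rcases Nat.eq_zero_or_pos (cvDen x n) with hz | hz
      · have hz' : q' = 0 := by rw [hq', hz]; simp
        have hp0 : p' = 0 := by rw [hz'] at h0; linarith
        rw [hz', hp0] at hdet
        rcases hsgn with hs | hs <;> rw [hs] at hdet <;> norm_num at hdet
      · have hz' : (0 : ℝ) < q' := by rw [hq']; exact_mod_cast hz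
        apply hirr
        refine ⟨(cvNum x n : ℚ) / cvDen x n, ?_⟩
        push_cast
        rw [div_eq_iff (by exact hz'.ne')]
        linarith
    set t : ℝ := (p - q * y) / (q' * y - p') with ht
    have hden : 0 < (-1 : ℝ) ^ n * (p' - q' * y) ∧ 0 < (-1 : ℝ) ^ n * (q * y - p)
        ∧ 0 < (-1 : ℝ) ^ n * ((M * p + p') - (M * q + q') * y) := by
      have a1 : y - p / q = (q * y - p) / q := by field_simp
      have a2 : y - (M * p + p') / (M * q + q') =
          ((M * q + q') * y - (M * p + p')) / (M * q + q') := by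
        field_simp
      have a3 : (M * p + p') / (M * q + q') - p / q = (-1) ^ n / (q * (M * q + q')) := by
        rw [← hdet]; field_simp; ring
      have b1 : p / q < y ↔ 0 < q * y - p := by
        rw [← sub_pos, a1, div_pos_iff_of_pos_right hqpos]
      have b2 : y < p / q ↔ q * y - p < 0 := by
        rw [← sub_neg, a1, div_neg_iff]
        constructor
        · rintro (h | h); exacts [absurd h.2 hqpos.not_gt, h.1]
        · exact fun h => Or.inr ⟨h, hqpos⟩
      have b3 : (M * p + p') / (M * q + q') < y ↔ 0 < (M * q + q') * y - (M * p + p') := by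
        rw [← sub_pos, a2, div_pos_iff_of_pos_right hMq]
      have b4 : y < (M * p + p') / (M * q + q') ↔ (M * q + q') * y - (M * p + p') < 0 := by
        rw [← sub_neg, a2, div_neg_iff]
        constructor
        · rintro (h | h); exacts [absurd h.2 hMq.not_gt, h.1]
        · exact fun h => Or.inr ⟨h, hMq⟩
      rw [b1, b2, b3, b4] at hy
      have b0 : 0 < 1 / (q * (M * q + q')) := by positivity
      rcases hsgn with hs | hs <;> rw [hs] at a3 hdet ⊢
      · have c1 : p / q < (M * p + p') / (M * q + q') := by linarith
        have d1 : 0 < q * y - p := by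
          rcases hy.1 with h | h
          · exact h
          · exact b1.1 (c1.trans (b3.2 h))
        have d2 : (M * q + q') * y - (M * p + p') < 0 := by
          rcases hy.2 with h | h
          · exact b4.1 ((b2.2 h).trans c1)
          · exact h
        refine ⟨by nlinarith, by linarith, by linarith⟩
      · have c1 : (M * p + p') / (M * q + q') < p / q := by
          have : (-1 : ℝ) / (q * (M * q + q')) = - (1 / (q * (M * q + q'))) := by ring
          linarith
        have d1 : q * y - p < 0 := by
          rcases hy.2 with h | h
          · exact h
          · exact b2.1 ((b4.2 h).trans c1)
        have d2 : 0 < (M * q + q') * y - (M * p + p') := by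
          rcases hy.1 with h | h
          · exact b3.1 (c1.trans (b1.2 h))
          · exact h
        refine ⟨by nlinarith, by linarith, by linarith⟩
    obtain ⟨d1, d2, d3⟩ := hden
    have hsq : (-1 : ℝ) ^ n * (-1) ^ n = 1 := by rw [← mul_pow]; simp
    have ht' : t = ((-1) ^ n * (q * y - p)) / ((-1) ^ n * (p' - q' * y)) := by
      rw [ht, mul_div_mul_left _ _ (left_ne_zero_of_mul d1.ne'),
        ← neg_div_neg_eq]
      ring_nf
    have ht0 : 0 < t := by rw [ht']; exact div_pos d2 d1
    have htM : t * M < 1 := by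
      rw [ht', div_mul_eq_mul_div, div_lt_one d1]
      nlinarith
    have hM1 : (1 : ℝ) ≤ M := by exact_mod_cast hM
    have ht1 : t < 1 := by nlinarith
    have hyt : y * (q + t * q') = p + t * p' := by
      have : t * (q' * y - p') = p - q * y := by
        rw [ht, div_mul_cancel₀ _ hne]
      linarith
    have htirr : Irrational t := by
      rintro ⟨r, hr⟩
      apply hirr
      have hpos : 0 < q + t * q' := by positivity
      refine ⟨(cvNum x (n + 1) + r * cvNum x n) / (cvDen x (n + 1) + r * cvDen x n), ?_⟩
      push_cast
      rw [hr, eq_comm, eq_div_iff hpos.ne']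
      exact hyt
    obtain ⟨z, hz, h1, h2, h3⟩ := exists_gaussIter_eq hx n (t := t) ⟨htirr, ht0, ht1⟩
    have hzy : z = y := by
      have hpos : 0 < q + t * q' := by positivity
      rw [h3, eq_comm, eq_div_iff hpos.ne']
      exact hyt
    subst hzy
    refine ⟨hz, h1, ?_⟩
    rw [le_cfA_iff hz hM, h2, lt_div_iff₀ hM']
    exact htM

lemma volume_irrational_inter (s : Set ℝ) :
    volume ({y : ℝ | Irrational y} ∩ s) = volume s := by
  apply measure_congr
  have h : {y : ℝ | Irrational y} =ᵐ[volume] univ := by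
    rw [eventuallyEq_univ]
    have : (range ((↑) : ℚ → ℝ)).Countable := countable_range _
    exact this.ae_notMem volume
  simpa using h.inter (ae_eq_refl s)

lemma volume_cylinder {x : ℝ} (hx : x ∈ irrUnit) (n : ℕ) {M : ℕ} (hM : 1 ≤ M) :
    volume {y | y ∈ irrUnit ∧ digits n y = digits n x ∧ M ≤ cfA y (n + 1)} =
      ENNReal.ofReal (1 / (cvDen x (n + 1) * (M * cvDen x (n + 1) + cvDen x n))) := by
  rw [cylinder_eq hx n hM, volume_irrational_inter, Real.volume_Ioo, max_sub_min_eq_abs]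
  congr 1
  have hdet : (cvNum x n : ℝ) * cvDen x (n + 1) - cvNum x (n + 1) * cvDen x n = (-1) ^ n := by
    exact_mod_cast cvNum_mul_cvDen x n
  have hqpos : (0 : ℝ) < cvDen x (n + 1) := by exact_mod_cast cvDen_pos hx n
  have hM' : (0 : ℝ) < M := by exact_mod_cast hM
  have : (M * cvNum x (n + 1) + cvNum x n : ℝ) / (M * cvDen x (n + 1) + cvDen x n)
      - (cvNum x (n + 1) : ℝ) / cvDen x (n + 1) =
      (-1) ^ n * (1 / (cvDen x (n + 1) * (M * cvDen x (n + 1) + cvDen x n))) := by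
    rw [← hdet]; field_simp; ring
  rw [this, abs_mul, abs_neg_one_pow, one_mul, abs_of_pos (by positivity)]

lemma fract_add_sub_fract_le (Y : ℝ) {t : ℝ} (ht : 0 ≤ t) :
    Int.fract (Y + t) - Int.fract Y ≤ t := by
  have h : (⌊Y⌋ : ℝ) ≤ ⌊Y + t⌋ := by exact_mod_cast Int.floor_mono (by linarith)
  rw [Int.fract, Int.fract]
  linarith

lemma le_fract_add_sub_fract (Y : ℝ) {t θ : ℝ} (ht : 0 ≤ t) (htθ : t ≤ θ) :
    Int.fract (Y + θ) - Int.fract Y - θ ≤ Int.fract (Y + t) - Int.fract Y := by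
  have h : (⌊Y + t⌋ : ℝ) ≤ ⌊Y + θ⌋ := by exact_mod_cast Int.floor_mono (by linarith)
  rw [Int.fract, Int.fract, Int.fract]
  linarith

lemma fract_add_div_eq (Y : ℝ) {q : ℕ} (hq : 0 < q) (k : ℤ) :
    Int.fract (Y + k / q) = (Int.fract (q * Y) + ((⌊q * Y⌋ + k) % q : ℤ)) / q := by
  have hq' : (0 : ℝ) < q := by exact_mod_cast hq
  have hqz : (0 : ℤ) < q := by exact_mod_cast hq
  set m := ⌊q * Y⌋ + k with hm
  have h1 := Int.emod_nonneg m hqz.ne'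
  have h2 := Int.emod_lt_of_pos m hqz
  have h2' : ((m % q : ℤ) : ℝ) + 1 ≤ q := by exact_mod_cast h2
  have h1' : (0 : ℝ) ≤ ((m % q : ℤ) : ℝ) := by exact_mod_cast h1
  have h3 := Int.fract_nonneg (q * Y)
  have h4 := Int.fract_lt_one (q * Y)
  rw [Int.fract_eq_iff]
  refine ⟨by positivity, ?_, m / q, ?_⟩
  · rw [div_lt_one hq']
    linarith
  · have h5 : ((m % q : ℤ) : ℝ) = m - q * (m / q : ℤ) := by
      have := Int.emod_def m q
      rw [this]; push_cast; ring
    rw [h5, hm, Int.fract]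
    push_cast
    field_simp
    ring

/-- The sum of the sawtooth over a full set of `q`-th roots of unity. -/
lemma sum_fract_add_div (Y : ℝ) {p q : ℕ} (hq : 0 < q) (hpq : p.Coprime q) :
    ∑ r ∈ Finset.range q, Int.fract (Y + (r * p : ℝ) / q)
      = Int.fract (q * Y) + ((q : ℝ) - 1) / 2 := by
  have hq' : (0 : ℝ) < q := by exact_mod_cast hq
  have hqz : (0 : ℤ) < q := by exact_mod_cast hq
  set m := ⌊q * Y⌋
  have h1 : ∀ r ∈ Finset.range q, Int.fract (Y + (r * p : ℝ) / q)
      = Int.fract (q * Y) / q + (((m + r * p) % q : ℤ) : ℝ) / q := by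
    intro r _
    have := fract_add_div_eq Y hq (r * p)
    push_cast at this
    rw [this, add_div]
  have h2 : ∑ r ∈ Finset.range q, (((m + r * p) % q : ℤ) : ℝ)
      = ∑ r ∈ Finset.range q, (r : ℝ) := by
    refine Finset.sum_bij' (i := fun r _ => ((m + r * p) % q : ℤ).toNat)
      (j := fun s _ => ((((s : ℤ) - m) * (p.gcdA q)) % q : ℤ).toNat) ?_ ?_ ?_ ?_ ?_
    · intro r _
      have := Int.emod_lt_of_pos (m + r * p) hqz
      have := Int.emod_nonneg (m + r * p) hqz.ne'
      simp only [Finset.mem_range]; omega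
    · intro s _
      have := Int.emod_lt_of_pos (((s : ℤ) - m) * (p.gcdA q)) hqz
      have := Int.emod_nonneg (((s : ℤ) - m) * (p.gcdA q)) hqz.ne'
      simp only [Finset.mem_range]; omega
    · intro r hr
      have hr := Finset.mem_range.1 hr
      have e1 := Int.emod_nonneg (m + r * p) hqz.ne'
      have hb := Nat.gcd_eq_gcd_ab p q
      rw [hpq] at hb
      have : ((((m + r * p) % q : ℤ).toNat : ℤ) - m) * p.gcdA q ≡ r [ZMOD q] := by
        rw [Int.toNat_of_nonneg e1]
        calc ((m + r * p) % q - m) * p.gcdA q ≡ ((m + r * p) - m) * p.gcdA q [ZMOD q] :=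
              ((Int.mod_modEq _ _).sub_right _).mul_right _
          _ = r + (q : ℤ) * (- r * p.gcdB q) := by
              push_cast at hb; linear_combination (-(r : ℤ)) * hb
          _ ≡ r [ZMOD q] := by simp [Int.ModEq]
      rw [this, Int.emod_eq_of_lt (by omega) (by omega)]
      simp
    · intro s hs
      have hs := Finset.mem_range.1 hs
      have e1 := Int.emod_nonneg (((s : ℤ) - m) * (p.gcdA q)) hqz.ne'
      have hb := Nat.gcd_eq_gcd_ab p q
      rw [hpq] at hb
      have : m + ((((s : ℤ) - m) * p.gcdA q) % q : ℤ).toNat * p ≡ s [ZMOD q] := by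
        rw [Int.toNat_of_nonneg e1]
        calc m + ((((s : ℤ) - m) * p.gcdA q) % q) * p
            ≡ m + (((s : ℤ) - m) * p.gcdA q) * p [ZMOD q] :=
              ((Int.mod_modEq _ _).mul_right _).add_left _
          _ = s + (q : ℤ) * (- (s - m) * p.gcdB q) := by
              push_cast at hb; linear_combination (-((s : ℤ) - m)) * hb
          _ ≡ s [ZMOD q] := by simp [Int.ModEq]
      rw [this, Int.emod_eq_of_lt (by omega) (by omega)]
      simp
    · intro r _
      have := Int.emod_nonneg (m + r * p) hqz.ne'
      have h := Int.toNat_of_nonneg this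
      exact_mod_cast (congrArg (fun z : ℤ => (z : ℝ)) h).symm
  have h3 : ∑ r ∈ Finset.range q, (r : ℝ) = q * (q - 1) / 2 := by
    have := Finset.sum_range_id_mul_two q
    have h4 : ((∑ i ∈ Finset.range q, i : ℕ) : ℝ) * 2 = q * ((q - 1 : ℕ) : ℝ) := by
      exact_mod_cast this
    rw [Nat.cast_pred hq] at h4
    push_cast at h4
    linarith
  rw [Finset.sum_congr rfl h1, Finset.sum_add_distrib, ← Finset.sum_div, ← Finset.sum_div, h2, h3]
  simp only [Finset.sum_const, Finset.card_range, nsmul_eq_mul]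
  field_simp

lemma sum_fract_block_bounds (Z x : ℝ) {p q : ℕ} (hq : 0 < q) (hpq : p.Coprime q) {θ : ℝ}
    (hθ : 0 ≤ θ) (hx : q * x = p + θ) (N : ℕ) :
    Int.fract (q * Z + N * (q * θ)) - Int.fract (q * Z) - N * (q * θ) ≤
      ∑ k ∈ Finset.range (N * q), Int.fract (Z + k * x)
        - ∑ j ∈ Finset.range N, (Int.fract (q * Z + j * (q * θ)) + ((q : ℝ) - 1) / 2) ∧
    ∑ k ∈ Finset.range (N * q), Int.fract (Z + k * x)
        - ∑ j ∈ Finset.range N, (Int.fract (q * Z + j * (q * θ)) + ((q : ℝ) - 1) / 2)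
      ≤ N * (q * θ) := by
  have hq' : (0 : ℝ) < q := by exact_mod_cast hq
  induction N with
  | zero => simp
  | succ N ih =>
    rw [add_mul, one_mul, Finset.sum_range_add, Finset.sum_range_succ _ N]
    set Y : ℕ → ℝ := fun r => (Z + N * θ) + (r * p : ℝ) / q with hY
    have h1 : ∀ r : ℕ, Int.fract (Z + ((N * q + r : ℕ) : ℝ) * x) = Int.fract (Y r + r * θ / q) := by
      intro r
      have : Z + ((N * q + r : ℕ) : ℝ) * x = (Y r + r * θ / q) + ((N * p : ℕ) : ℤ) := by
        have hx' : x = (p + θ) / q := by field_simp; linarith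
        rw [hY, hx']; push_cast; field_simp; ring
      rw [this, Int.fract_add_intCast]
    simp_rw [h1]
    have h2 : ∑ r ∈ Finset.range q, Int.fract (Y r)
        = Int.fract (q * Z + N * (q * θ)) + ((q : ℝ) - 1) / 2 := by
      rw [hY, sum_fract_add_div _ hq hpq]; congr 2; ring
    have h3 : ∑ r ∈ Finset.range q, Int.fract (Y r + θ)
        = Int.fract (q * Z + (N + 1 : ℕ) * (q * θ)) + ((q : ℝ) - 1) / 2 := by
      have : ∀ r, Y r + θ = (Z + N * θ + θ) + (r * p : ℝ) / q := fun r => by rw [hY]; ring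
      simp_rw [this]
      rw [sum_fract_add_div _ hq hpq]; congr 2; push_cast; ring
    have hr : ∀ r ∈ Finset.range q, 0 ≤ (r : ℝ) * θ / q ∧ (r : ℝ) * θ / q ≤ θ := by
      intro r hr
      have : (r : ℝ) ≤ q := by exact_mod_cast (Finset.mem_range.1 hr).le
      exact ⟨by positivity, by rw [div_le_iff₀ hq']; nlinarith⟩
    have h4 : ∑ r ∈ Finset.range q, (Int.fract (Y r + r * θ / q) - Int.fract (Y r))
        ≤ ∑ r ∈ Finset.range q, θ := Finset.sum_le_sum fun r h =>
          (fract_add_sub_fract_le _ (hr r h).1).trans (hr r h).2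
    have h5 : ∑ r ∈ Finset.range q, (Int.fract (Y r + θ) - Int.fract (Y r) - θ) ≤
        ∑ r ∈ Finset.range q, (Int.fract (Y r + r * θ / q) - Int.fract (Y r)) :=
      Finset.sum_le_sum fun r h => le_fract_add_sub_fract _ (hr r h).1 (hr r h).2
    simp only [Finset.sum_sub_distrib, Finset.sum_const, Finset.card_range, nsmul_eq_mul]
      at h4 h5
    rw [h2] at h4 h5
    rw [h3] at h5
    push_cast at h5 ⊢
    constructor <;> linarith [ih.1, ih.2]

lemma intervalIntegrable_fract (w a b : ℝ) :
    IntervalIntegrable (fun y : ℝ => Int.fract (y + w)) volume a b := by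
  refine (intervalIntegrable_const (c := (1 : ℝ))).mono_fun ?_ ?_
  · exact (measurable_fract.comp (measurable_id.add_const w)).aestronglyMeasurable
  · refine Eventually.of_forall fun y => ?_
    show ‖Int.fract (y + w)‖ ≤ ‖(1 : ℝ)‖
    rw [Real.norm_of_nonneg (Int.fract_nonneg _), norm_one]
    exact (Int.fract_lt_one _).le

lemma integral_fract_bounds (w : ℝ) {a b : ℝ} (hab : a ≤ b) :
    0 ≤ ∫ y in a..b, Int.fract (y + w) ∧ ∫ y in a..b, Int.fract (y + w) ≤ b - a := by
  constructor
  · exact intervalIntegral.integral_nonneg hab fun _ _ => Int.fract_nonneg _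
  · have := intervalIntegral.integral_mono_on hab (intervalIntegrable_fract w a b)
      (intervalIntegrable_const (c := (1 : ℝ))) fun y _ => (Int.fract_lt_one (y + w)).le
    simpa using this

lemma abs_integral_fract_shift (w c : ℝ) {ε : ℝ} (hε : 0 ≤ ε) :
    |(∫ y in (0 : ℝ)..c, Int.fract (y + (w + ε))) - ∫ y in (0 : ℝ)..c, Int.fract (y + w)| ≤ ε := by
  have h1 : ∫ y in (0 : ℝ)..c, Int.fract (y + (w + ε))
      = ∫ y in ε..(c + ε), Int.fract (y + w) := by
    have := intervalIntegral.integral_comp_add_right (a := 0) (b := c)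
      (fun y => Int.fract (y + w)) ε
    rw [zero_add] at this
    rw [← this]
    congr 1; ext y; congr 1; ring
  have i := intervalIntegrable_fract w
  have h2 := intervalIntegral.integral_interval_sub_interval_comm (i ε (c + ε)) (i 0 c) (i ε 0)
  have h3 := integral_fract_bounds w hε
  have h4 := integral_fract_bounds w (show c ≤ c + ε by linarith)
  rw [h1, h2, intervalIntegral.integral_symm, intervalIntegral.integral_symm c (c + ε), abs_le]
  constructor <;> linarith

lemma fract_le_of_abs_sub_le {A B ε : ℝ} (h : |A - B| ≤ ε) :
    Int.fract (B + ε) - 2 * ε ≤ Int.fract A ∧ Int.fract A ≤ Int.fract (B - ε) + 2 * ε := by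
  rw [abs_le] at h
  have h1 : (⌊A⌋ : ℝ) ≤ ⌊B + ε⌋ := by exact_mod_cast Int.floor_mono (by linarith)
  have h2 : (⌊B - ε⌋ : ℝ) ≤ ⌊A⌋ := by exact_mod_cast Int.floor_mono (by linarith)
  simp only [Int.fract]
  constructor <;> linarith

lemma abs_riemann_sum_fract_sub_integral_le {a N : ℕ} (ha : 0 < a) (hN : N ≤ a) {τ W w ρ : ℝ}
    (hτ1 : 1 / ((a : ℝ) + 2) ≤ τ) (hτ2 : τ ≤ 1 / a) (hW : |W - w| ≤ ρ) :
    |(∑ j ∈ Finset.range N, Int.fract (W + j * τ)) / a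
      - ∫ y in (0 : ℝ)..(N / a), Int.fract (y + w)| ≤ 3 * (ρ + 3 / a) := by
  have ha' : (0 : ℝ) < a := by exact_mod_cast ha
  have hρ : 0 ≤ ρ := (abs_nonneg _).trans hW
  set ε := ρ + 3 / a with hε
  have hε0 : 0 ≤ ε := by positivity
  have key : ∀ j < N, ∀ y ∈ Icc ((j : ℝ) / a) (((j + 1 : ℕ) : ℝ) / a),
      |(W + j * τ) - (y + w)| ≤ ε := by
    intro j hj y hy
    have hja : (j : ℝ) + 1 ≤ a := by exact_mod_cast hj.trans_le hN
    have e1 : (j : ℝ) * τ ≤ j / a := by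
      calc (j : ℝ) * τ ≤ j * (1 / a) := by gcongr
        _ = j / a := by ring
    have e2 : (j : ℝ) / (a + 2) ≤ j * τ := by
      calc (j : ℝ) / (a + 2) = j * (1 / (a + 2)) := by ring
        _ ≤ j * τ := by gcongr
    have e3 : ((j + 1 : ℕ) : ℝ) / a - j / (a + 2) ≤ 3 / a := by
      push_cast
      rw [div_sub_div _ _ ha'.ne' (by positivity), div_le_div_iff₀ (by positivity) ha']
      nlinarith [(Nat.cast_nonneg j : (0 : ℝ) ≤ j)]
    rw [abs_le] at hW ⊢
    constructor <;> linarith [hy.1, hy.2]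
  have hsum : ∀ v : ℝ, ∑ j ∈ Finset.range N, ∫ y in ((j : ℝ) / a)..(((j + 1 : ℕ) : ℝ) / a),
      Int.fract (y + v) = ∫ y in (0 : ℝ)..(N / a), Int.fract (y + v) := by
    intro v
    rw [intervalIntegral.sum_integral_adjacent_intervals (a := fun j : ℕ => (j : ℝ) / a)
      fun k _ => intervalIntegrable_fract v _ _]
    simp
  have hlen : ∀ j : ℕ, ((j + 1 : ℕ) : ℝ) / a - (j : ℝ) / a = 1 / a := by
    intro j; push_cast; ring
  have hle : ∀ j : ℕ, (j : ℝ) / a ≤ ((j + 1 : ℕ) : ℝ) / a := by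
    intro j; have := hlen j; have : (0 : ℝ) < 1 / a := by positivity
    linarith
  have hNa : (N : ℝ) / a ≤ 1 := by rw [div_le_one ha']; exact_mod_cast hN
  have up : (∑ j ∈ Finset.range N, Int.fract (W + j * τ)) / a
      ≤ (∫ y in (0 : ℝ)..(N / a), Int.fract (y + (w - ε))) + 2 * ε * (N / a) := by
    rw [Finset.sum_div, ← hsum]
    have : 2 * ε * ((N : ℝ) / a) = ∑ j ∈ Finset.range N, 2 * ε * (1 / a) := by simp; ring
    rw [this, ← Finset.sum_add_distrib]
    refine Finset.sum_le_sum fun j hj => ?_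
    have h := intervalIntegral.integral_mono_on (hle j)
      (intervalIntegrable_const (c := Int.fract (W + j * τ) - 2 * ε))
      (intervalIntegrable_fract (w - ε) _ _) (fun y hy => by
        have := (fract_le_of_abs_sub_le (key j (Finset.mem_range.1 hj) y hy)).2
        rw [← add_sub_assoc]; linarith)
    rw [intervalIntegral.integral_const, hlen, smul_eq_mul] at h
    have e : Int.fract (W + j * τ) / a
      = 1 / a * (Int.fract (W + j * τ) - 2 * ε) + 2 * ε * (1 / a) := by ring
    linarith
  have lo : (∫ y in (0 : ℝ)..(N / a), Int.fract (y + (w + ε))) - 2 * ε * (N / a)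
      ≤ (∑ j ∈ Finset.range N, Int.fract (W + j * τ)) / a := by
    rw [Finset.sum_div, ← hsum]
    have : 2 * ε * ((N : ℝ) / a) = ∑ j ∈ Finset.range N, 2 * ε * (1 / a) := by simp; ring
    rw [this, ← Finset.sum_sub_distrib]
    refine Finset.sum_le_sum fun j hj => ?_
    have h := intervalIntegral.integral_mono_on (hle j)
      (intervalIntegrable_fract (w + ε) _ _)
      (intervalIntegrable_const (c := Int.fract (W + j * τ) + 2 * ε)) (fun y hy => by
        have := (fract_le_of_abs_sub_le (key j (Finset.mem_range.1 hj) y hy)).1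
        rw [← add_assoc]; linarith)
    rw [intervalIntegral.integral_const, hlen, smul_eq_mul] at h
    have e : Int.fract (W + j * τ) / a
      = 1 / a * (Int.fract (W + j * τ) + 2 * ε) - 2 * ε * (1 / a) := by ring
    linarith
  have s1 := abs_le.1 (abs_integral_fract_shift w (N / a) hε0)
  have s2 := abs_le.1 (abs_integral_fract_shift (w - ε) (N / a) hε0)
  rw [sub_add_cancel] at s2
  have : 2 * ε * ((N : ℝ) / a) ≤ 2 * ε := by nlinarith
  rw [abs_le]
  constructor <;> linarith [s1.1, s1.2, s2.1, s2.2]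

/-- Birkhoff sums of the centered sawtooth along multiples of a convergent denominator `q`,
normalised by the next partial quotient `a`, are close to an integral of the sawtooth. -/
lemma abs_sum_sawtooth_sub_integral_le (Z x : ℝ) {p q a : ℕ} (hq : 0 < q) (hpq : p.Coprime q)
    (ha : 0 < a) {θ : ℝ} (hx : q * x = p + θ) (hθ1 : 1 / ((a : ℝ) + 2) ≤ q * θ)
    (hθ2 : q * θ ≤ 1 / a) {w ρ : ℝ} {m : ℤ} (hw : |q * Z - m - w| ≤ ρ) {c : ℝ}
    (hc : c ∈ Icc (0 : ℝ) 1) :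
    |(∑ k ∈ Finset.range (⌊c * a⌋₊ * q), (Int.fract (Z + k * x) - 1 / 2)) / a
      - ((∫ y in (0 : ℝ)..c, Int.fract (y + w)) - c / 2)| ≤ 3 * ρ + 13 / a := by
  have ha' : (0 : ℝ) < a := by exact_mod_cast ha
  have hq' : (0 : ℝ) < q := by exact_mod_cast hq
  have hθ : 0 ≤ θ := by
    have : 0 < (q : ℝ) * θ := lt_of_lt_of_le (by positivity) hθ1
    exact (pos_of_mul_pos_right this hq'.le).le
  set N := ⌊c * a⌋₊ with hN
  have hca : 0 ≤ c * a := mul_nonneg hc.1 ha'.le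
  have hN1 : (N : ℝ) ≤ c * a := Nat.floor_le hca
  have hN2 : c * a < N + 1 := Nat.lt_floor_add_one _
  have hNa : N ≤ a := by
    have : (N : ℝ) ≤ a := hN1.trans (by nlinarith [hc.2])
    exact_mod_cast this
  obtain ⟨b1, b2⟩ := sum_fract_block_bounds Z x hq hpq hθ hx N
  have hNτ : (N : ℝ) * (q * θ) ≤ 1 := by
    have h1 : (N : ℝ) * (q * θ) ≤ a * (1 / a) := by
      have : (N : ℝ) ≤ a := by exact_mod_cast hNa
      gcongr
    rwa [mul_one_div_cancel ha'.ne'] at h1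
  have r := abs_le.1 (abs_riemann_sum_fract_sub_integral_le ha hNa hθ1 hθ2 hw)
  have e1 : ∑ j ∈ Finset.range N, Int.fract (q * Z - m + j * (q * θ))
      = ∑ j ∈ Finset.range N, Int.fract (q * Z + j * (q * θ)) := by
    refine Finset.sum_congr rfl fun j _ => ?_
    rw [sub_add_eq_add_sub, Int.fract_sub_intCast]
  rw [e1] at r
  have f1 := Int.fract_nonneg (q * Z + N * (q * θ))
  have f2 := Int.fract_lt_one (q * Z)
  have hNτ0 : 0 ≤ (N : ℝ) * (q * θ) := by positivity
  have hNc : (N : ℝ) / a ≤ c := by rw [div_le_iff₀ ha']; exact hN1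
  have hNc' : c - N / a ≤ 1 / a := by
    rw [sub_le_iff_le_add, ← add_div, le_div_iff₀ ha']; linarith
  have g := integral_fract_bounds w hNc
  have g2 := intervalIntegral.integral_add_adjacent_intervals
    (intervalIntegrable_fract w 0 (N / a)) (intervalIntegrable_fract w (N / a) c)
  rw [Finset.sum_sub_distrib, Finset.sum_const, Finset.card_range, nsmul_eq_mul]
  rw [Finset.sum_add_distrib, Finset.sum_const, Finset.card_range, nsmul_eq_mul] at b1 b2
  set S := ∑ k ∈ Finset.range (N * q), Int.fract (Z + k * x)
  set T := ∑ j ∈ Finset.range N, Int.fract (q * Z + j * (q * θ))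
  have e2 : (S - ((N * q : ℕ) : ℝ) * (1 / 2)) / a
      = T / a + (S - (T + N * (((q : ℝ) - 1) / 2))) / a - (N / a) / 2 := by
    push_cast; field_simp; ring
  rw [e2]
  have e3 : (S - (T + N * (((q : ℝ) - 1) / 2))) / a ≤ 2 / a := by gcongr; linarith
  have e4 : -(2 / a) ≤ (S - (T + N * (((q : ℝ) - 1) / 2))) / a := by
    rw [← neg_div]; gcongr; linarith
  have e5 : (13 : ℝ) / a = 13 * (1 / a) := by ring
  have e6 : (3 : ℝ) / a = 3 * (1 / a) := by ring
  have e7 : (2 : ℝ) / a = 2 * (1 / a) := by ring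
  have e8 : 0 < 1 / (a : ℝ) := by positivity
  rw [e6] at r
  rw [e7] at e3 e4
  rw [e5, abs_le]
  constructor <;> linarith [r.1, r.2, g.1, g.2]

lemma measurableSet_irrUnit : MeasurableSet irrUnit := by
  have h : {x : ℝ | Irrational x} = (range ((↑) : ℚ → ℝ))ᶜ := rfl
  have h1 : MeasurableSet {x : ℝ | Irrational x} := by
    rw [h]
    exact (countable_range _).measurableSet.compl
  exact h1.inter measurableSet_Ioo

/-- Lebesgue measure on the irrational numbers of the unit interval. -/
noncomputable def irrMeasure : Measure ℝ := volume.restrict irrUnit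

instance : IsProbabilityMeasure irrMeasure := by
  constructor
  rw [irrMeasure, Measure.restrict_apply_univ]
  have : irrUnit = {y : ℝ | Irrational y} ∩ Ioo 0 1 := rfl
  rw [this, volume_irrational_inter]
  simp

lemma irrMeasure_compl : irrMeasure irrUnitᶜ = 0 := by
  rw [irrMeasure, Measure.restrict_apply measurableSet_irrUnit.compl]
  simp

lemma ae_mem_irrUnit : ∀ᵐ x ∂irrMeasure, x ∈ irrUnit :=
  ae_restrict_mem measurableSet_irrUnit

lemma irrMeasure_apply (s : Set ℝ) : irrMeasure s = volume (s ∩ irrUnit) :=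
  Measure.restrict_apply' measurableSet_irrUnit

lemma measurable_gaussIter : ∀ n, Measurable fun x => gaussIter x n
  | 0 => measurable_fract
  | n + 1 => measurable_fract.comp ((measurable_gaussIter n).const_div 1)

lemma measurable_digits (n : ℕ) : Measurable (digits n) := by
  refine measurable_pi_lambda _ fun i => ?_
  simp only [digits, cfA_succ]
  exact Nat.measurable_floor.comp ((measurable_gaussIter i).const_div 1)

lemma measurable_of_digits {β : Type*} [MeasurableSpace β] (n : ℕ) {f : ℝ → β}
    (hf : ∀ x y, digits n x = digits n y → f x = f y) : Measurable f := by
  have hf' : Function.FactorsThrough f (digits n) := fun x y h => hf x y h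
  have : Nonempty β := ⟨f 0⟩
  obtain ⟨g, rfl⟩ := (Function.factorsThrough_iff f).1 hf'
  exact (measurable_of_countable g).comp (measurable_digits n)

lemma measurableSet_of_digits (n : ℕ) {s : Set ℝ}
    (hs : ∀ x y, digits n x = digits n y → (x ∈ s ↔ y ∈ s)) : MeasurableSet s := by
  have : Measurable fun x => x ∈ s := measurable_of_digits n fun x y h => propext (hs x y h)
  exact measurableSet_setOfPred.2 this

/-- Comparison of integrals of functions of the first `n` digits, cylinder by cylinder. -/
lemma lintegral_le_of_digits {n : ℕ} {m₁ m₂ : Measure ℝ} (h₁ : m₁ irrUnitᶜ = 0)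
    {u v : ℝ → ENNReal} (hu : ∀ x y, digits n x = digits n y → u x = u y)
    (hv : ∀ x y, digits n x = digits n y → v x = v y)
    (h : ∀ x ∈ irrUnit, u x * m₁ (digits n ⁻¹' {digits n x})
      ≤ v x * m₂ (digits n ⁻¹' {digits n x})) :
    ∫⁻ x, u x ∂m₁ ≤ ∫⁻ x, v x ∂m₂ := by
  have hu' : Function.FactorsThrough u (digits n) := fun x y h => hu x y h
  have hv' : Function.FactorsThrough v (digits n) := fun x y h => hv x y h
  obtain ⟨u, rfl⟩ := (Function.factorsThrough_iff u).1 hu'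
  obtain ⟨v, rfl⟩ := (Function.factorsThrough_iff v).1 hv'
  simp only [Function.comp_apply] at h ⊢
  rw [← lintegral_map (measurable_of_countable u) (measurable_digits n),
    ← lintegral_map (measurable_of_countable v) (measurable_digits n),
    lintegral_countable', lintegral_countable']
  refine ENNReal.tsum_le_tsum fun w => ?_
  rw [Measure.map_apply (measurable_digits n) (measurableSet_singleton w),
    Measure.map_apply (measurable_digits n) (measurableSet_singleton w)]
  by_cases hw : ∃ x ∈ irrUnit, digits n x = w
  · obtain ⟨x, hx, rfl⟩ := hw
    exact h x hx
  · have : m₁ (digits n ⁻¹' {w}) = 0 :=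
      measure_mono_null (fun y hy hy' => hw ⟨y, hy', hy⟩) h₁
    simp [this]

lemma irrMeasure_fiber {x : ℝ} (hx : x ∈ irrUnit) (n : ℕ) :
    irrMeasure (digits n ⁻¹' {digits n x}) =
      ENNReal.ofReal (1 / (cvDen x (n + 1) * (cvDen x (n + 1) + cvDen x n))) := by
  have := volume_cylinder hx n le_rfl
  rw [Nat.cast_one, one_mul] at this
  rw [irrMeasure_apply, ← this]
  congr 1
  ext y
  constructor
  · rintro ⟨h1, h2⟩
    exact ⟨h2, h1, one_le_cfA h2 n⟩
  · rintro ⟨h1, h2, -⟩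
    exact ⟨h2, h1⟩

lemma irrMeasure_fiber_inter_le {x : ℝ} (hx : x ∈ irrUnit) (n : ℕ) {M : ℕ} (hM : 1 ≤ M) :
    irrMeasure (digits n ⁻¹' {digits n x} ∩ {y | M ≤ cfA y (n + 1)}) ≤
      ENNReal.ofReal (2 / M) * irrMeasure (digits n ⁻¹' {digits n x}) := by
  have h := volume_cylinder hx n hM
  have hM' : (1 : ℝ) ≤ M := by exact_mod_cast hM
  have h0 : (0 : ℝ) < cvDen x (n + 1) := by exact_mod_cast cvDen_pos hx n
  have h1 : (cvDen x n : ℝ) ≤ cvDen x (n + 1) := by exact_mod_cast cvDen_le_succ hx n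
  have h2 : (0 : ℝ) ≤ cvDen x n := by positivity
  rw [irrMeasure_fiber hx, ← ENNReal.ofReal_mul (by positivity), irrMeasure_apply]
  have he : digits n ⁻¹' {digits n x} ∩ {y | M ≤ cfA y (n + 1)} ∩ irrUnit =
      {y | y ∈ irrUnit ∧ digits n y = digits n x ∧ M ≤ cfA y (n + 1)} := by
    ext y
    simp only [mem_inter_iff, mem_preimage, mem_singleton_iff, mem_ofPred_eq]
    tauto
  rw [he, h]
  apply ENNReal.ofReal_le_ofReal
  rw [div_mul_div_comm, div_le_div_iff₀ (by positivity) (by positivity)]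
  have : (M : ℝ) * (cvDen x (n + 1) + cvDen x n) ≤ 2 * (M * cvDen x (n + 1) + cvDen x n) := by
    nlinarith
  nlinarith

lemma le_irrMeasure_fiber_inter {x : ℝ} (hx : x ∈ irrUnit) (n : ℕ) {k M : ℕ} (hk : 1 ≤ k)
    (hM : 1 ≤ M) :
    ENNReal.ofReal (1 / ((k + 1) ^ 2 * M)) * irrMeasure (digits n ⁻¹' {digits n x}) ≤
      irrMeasure (digits n ⁻¹' {digits n x} ∩
        {y | cfA y (n + 1) = k ∧ M ≤ cfA y (n + 2)}) := by
  obtain ⟨y, hy, h1, h2, -⟩ := exists_gaussIter_eq hx n (inv_add_mem hk hx)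
  obtain ⟨h3, -⟩ := cfA_eq_of_gaussIter_eq hy hx.2 h2
  have h := volume_cylinder hy (n + 1) hM
  obtain ⟨e1, -, e2, -⟩ := cv_congr h1
  have hM' : (1 : ℝ) ≤ M := by exact_mod_cast hM
  have hk' : (1 : ℝ) ≤ k := by exact_mod_cast hk
  have g0 : (0 : ℝ) < cvDen x (n + 1) := by exact_mod_cast cvDen_pos hx n
  have g1 : (cvDen x n : ℝ) ≤ cvDen x (n + 1) := by exact_mod_cast cvDen_le_succ hx n
  have g2 : (0 : ℝ) ≤ cvDen x n := by positivity
  have e3 : (cvDen y (n + 1 + 1) : ℝ) = k * cvDen x (n + 1) + cvDen x n := by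
    rw [cvDen, h3, e1, e2]
    push_cast
    rfl
  rw [irrMeasure_fiber hx, ← ENNReal.ofReal_mul (by positivity), irrMeasure_apply]
  have he : digits n ⁻¹' {digits n x} ∩ {y | cfA y (n + 1) = k ∧ M ≤ cfA y (n + 2)} ∩ irrUnit =
      {z | z ∈ irrUnit ∧ digits (n + 1) z = digits (n + 1) y ∧ M ≤ cfA z (n + 1 + 1)} := by
    ext z
    simp only [mem_inter_iff, mem_preimage, mem_singleton_iff, mem_ofPred_eq]
    have : digits (n + 1) z = digits (n + 1) y ↔ digits n z = digits n x ∧ cfA z (n + 1) = k := by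
      rw [← h1, digits_eq_iff, digits_eq_iff, ← h3]
      constructor
      · exact fun H => ⟨fun i hi => H i (by omega), H n (by omega)⟩
      · rintro ⟨H1, H2⟩ i hi
        rcases Nat.lt_succ_iff_lt_or_eq.1 hi with hi | rfl
        · exact H1 i hi
        · exact H2
    rw [this]
    tauto
  rw [he, h, e3, e1]
  apply ENNReal.ofReal_le_ofReal
  rw [div_mul_div_comm, div_le_div_iff₀ (by positivity) (by positivity)]
  have b1 : (k * cvDen x (n + 1) + cvDen x n : ℝ) ≤ (k + 1) * cvDen x (n + 1) := by linarith
  have b2 : (M * (k * cvDen x (n + 1) + cvDen x n) + cvDen x (n + 1) : ℝ)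
      ≤ M * ((k + 1) * (cvDen x (n + 1) + cvDen x n)) := by
    nlinarith [mul_nonneg (by linarith : (0 : ℝ) ≤ M) (mul_nonneg (by linarith : (0 : ℝ) ≤ k) g2),
      mul_nonneg (by linarith : (0 : ℝ) ≤ M - 1) g0.le]
  have := mul_le_mul b1 b2 (by positivity) (by positivity)
  nlinarith

lemma irrMeasure_le_cfA (n : ℕ) {M : ℕ} (hM : 1 ≤ M) :
    irrMeasure {y | M ≤ cfA y (n + 1)} ≤ ENNReal.ofReal (2 / M) := by
  have hm : MeasurableSet {y : ℝ | M ≤ cfA y (n + 1)} :=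
    measurableSet_of_digits (n + 1) fun x y h => by
      simp [digits_eq_iff.1 h n n.lt_succ_self]
  have := lintegral_le_of_digits (n := n) (m₁ := irrMeasure.restrict {y | M ≤ cfA y (n + 1)})
    (m₂ := irrMeasure) (u := fun _ => 1) (v := fun _ => ENNReal.ofReal (2 / M))
    (by
      rw [Measure.restrict_apply' hm]
      exact measure_mono_null inter_subset_left irrMeasure_compl)
    (fun _ _ _ => rfl) (fun _ _ _ => rfl)
    (fun x hx => by
      rw [Measure.restrict_apply' hm, one_mul]
      exact irrMeasure_fiber_inter_le hx n hM)
  simpa using this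

lemma one_add_sum_le_prod {ι : Type*} (s : Finset ι) {f : ι → ℝ} (hf : ∀ i, 0 ≤ f i) :
    1 + ∑ i ∈ s, f i ≤ ∏ i ∈ s, (1 + f i) := by
  classical
  induction s using Finset.induction_on with
  | empty => simp
  | insert a s ha ih =>
    rw [Finset.sum_insert ha, Finset.prod_insert ha]
    nlinarith [hf a, Finset.sum_nonneg fun i (_ : i ∈ s) => hf i]

/-- A conditional Borel-Cantelli lemma along the digit filtration. -/
lemma ae_frequently_of_not_summable {E : ℕ → Set ℝ} {p : ℕ → ℝ → ℝ} (hp0 : ∀ i x, 0 ≤ p i x)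
    (hp : ∀ i x y, digits (2 * i + 1) x = digits (2 * i + 1) y → p i x = p i y)
    (hE : ∀ i x y, digits (2 * i + 3) x = digits (2 * i + 3) y → (x ∈ E i ↔ y ∈ E i))
    (h : ∀ i, ∀ x ∈ irrUnit, ENNReal.ofReal (1 + p i x) *
      irrMeasure (digits (2 * i + 1) ⁻¹' {digits (2 * i + 1) x} ∩ (E i)ᶜ) ≤
        irrMeasure (digits (2 * i + 1) ⁻¹' {digits (2 * i + 1) x})) :
    ∀ᵐ x ∂irrMeasure, ¬ Summable (fun i => p i x) → ∃ᶠ i in atTop, x ∈ E i := by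
  have hEm : ∀ i, MeasurableSet (E i) := fun i => measurableSet_of_digits _ (hE i)
  have key : ∀ M : ℕ, ∀ᵐ x ∂irrMeasure, (∀ i ≥ M, x ∉ E i) → Summable (fun i => p i x) := by
    intro M
    set V : ℕ → ℝ → ENNReal := fun n x =>
      ∏ i ∈ Finset.Ico M n, (E i)ᶜ.indicator (fun x => ENNReal.ofReal (1 + p i x)) x with hV
    have hVd : ∀ n x y, digits (2 * n + 1) x = digits (2 * n + 1) y → V n x = V n y := by
      intro n x y hxy
      refine Finset.prod_congr rfl fun i hi => ?_
      have hi' := (Finset.mem_Ico.1 hi).2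
      have h1 := hE i x y (digits_mono (by omega) hxy)
      have h2 := hp i x y (digits_mono (by omega) hxy)
      by_cases hx : x ∈ E i
      · rw [indicator_of_notMem (by simpa using hx),
          indicator_of_notMem (by simpa using h1.1 hx)]
      · rw [indicator_of_mem hx, indicator_of_mem (show y ∈ (E i)ᶜ from fun hy => hx (h1.2 hy)), h2]
    have hVm : ∀ n, Measurable (V n) := fun n => measurable_of_digits _ (hVd n)
    have hstep : ∀ n, M ≤ n → ∫⁻ x, V (n + 1) x ∂irrMeasure ≤ ∫⁻ x, V n x ∂irrMeasure := by
      intro n hn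
      have e : ∀ x, V (n + 1) x =
          (E n)ᶜ.indicator (fun x => V n x * ENNReal.ofReal (1 + p n x)) x := by
        intro x
        simp only [hV]
        rw [Finset.prod_Ico_succ_top hn]
        by_cases hx : x ∈ E n
        · rw [indicator_of_notMem (by simpa using hx), indicator_of_notMem (by simpa using hx),
            mul_zero]
        · rw [indicator_of_mem hx, indicator_of_mem hx]
      simp_rw [e]
      rw [lintegral_indicator (hEm n).compl]
      refine lintegral_le_of_digits (n := 2 * n + 1) ?_ ?_ (hVd n) ?_
      · rw [Measure.restrict_apply' (hEm n).compl]
        exact measure_mono_null inter_subset_left irrMeasure_compl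
      · intro x y hxy
        rw [hVd n x y hxy, hp n x y hxy]
      · intro x hx
        rw [Measure.restrict_apply' (hEm n).compl, mul_assoc]
        gcongr
        exact h n x hx
    have hle : ∀ k, ∫⁻ x, V (M + k) x ∂irrMeasure ≤ 1 := by
      intro k
      induction k with
      | zero => simp [hV]
      | succ k ih => exact (hstep (M + k) (by omega)).trans ih
    have hlim : ∫⁻ x, liminf (fun k => V (M + k) x) atTop ∂irrMeasure ≤ 1 := by
      refine (lintegral_liminf_le fun k => hVm (M + k)).trans ?_
      refine (liminf_le_liminf (Eventually.of_forall hle)).trans ?_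
      simp
    have hfin := ae_lt_top (Measurable.liminf fun k => hVm (M + k))
      (hlim.trans_lt ENNReal.one_lt_top).ne
    filter_upwards [hfin] with x hx hxE
    obtain ⟨C, hC, hC'⟩ := exists_between hx
    have hfr := frequently_lt_of_liminf_lt (by isBoundedDefault) hC
    have hVx : ∀ k, ENNReal.ofReal (∑ i ∈ Finset.Ico M (M + k), p i x) ≤ V (M + k) x := by
      intro k
      have : V (M + k) x = ENNReal.ofReal (∏ i ∈ Finset.Ico M (M + k), (1 + p i x)) := by
        rw [ENNReal.ofReal_prod_of_nonneg fun i _ => by linarith [hp0 i x]]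
        refine Finset.prod_congr rfl fun i hi => ?_
        exact indicator_of_mem (hxE i (Finset.mem_Ico.1 hi).1) _
      rw [this]
      apply ENNReal.ofReal_le_ofReal
      have := one_add_sum_le_prod (Finset.Ico M (M + k)) fun i => hp0 i x
      linarith
    rw [← summable_nat_add_iff M]
    refine summable_of_sum_range_le (c := C.toReal) (fun i => hp0 _ _) fun k => ?_
    obtain ⟨l, hkl, hl⟩ := (frequently_atTop.1 hfr) k
    have h1 : ∑ i ∈ Finset.range k, p (i + M) x ≤ ∑ i ∈ Finset.Ico M (M + l), p i x := by
      rw [Finset.sum_Ico_eq_sum_range]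
      simp only [add_comm M]
      exact Finset.sum_le_sum_of_subset_of_nonneg (Finset.range_mono (by omega))
        fun i _ _ => hp0 _ _
    refine h1.trans ?_
    rw [← ENNReal.ofReal_le_iff_le_toReal hC'.ne]
    exact (hVx l).trans hl.le
  filter_upwards [ae_all_iff.2 key] with x hx hns
  by_contra hfr
  rw [not_frequently, eventually_atTop] at hfr
  obtain ⟨M, hM⟩ := hfr
  exact hns (hx M hM)

lemma exists_coprime_mul_add {a b R : ℕ} (hb : 0 < b) (hR : 0 < R) (h : a.Coprime b) :
    ∃ k, 1 ≤ k ∧ k ≤ R ∧ (k * b + a).Coprime R := by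
  obtain ⟨p, hp, hpp, hpa⟩ := Nat.forall_exists_prime_gt_and_modEq (R + a + b) hb.ne' h
  obtain ⟨m, hm⟩ := (Nat.modEq_iff_dvd' (by omega : a ≤ p)).1 hpa.symm
  have hpe : p = m * b + a := by
    rw [mul_comm m b, ← hm]
    omega
  have hcop : (m * b + a).Coprime R := by
    rw [← hpe, hpp.coprime_iff_not_dvd]
    intro hd
    have := Nat.le_of_dvd hR hd
    omega
  have hm0 : 0 < m := by
    rcases Nat.eq_zero_or_pos m with rfl | h0
    · omega
    · exact h0
  refine ⟨(m - 1) % R + 1, by omega, Nat.mod_lt _ hR, ?_⟩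
  have hmod : ((m - 1) % R + 1) * b + a ≡ m * b + a [MOD R] := by
    refine Nat.ModEq.add_right _ (Nat.ModEq.mul_right _ ?_)
    have := Nat.ModEq.add_right 1 (Nat.mod_modEq (m - 1) R)
    rwa [Nat.sub_add_cancel hm0] at this
  rw [Nat.Coprime, hmod.gcd_eq]
  exact hcop

open Classical in
/-- A number `k ∈ [1, R]` with `k * b + a` coprime to `R`, if there is one. -/
noncomputable def coprimeShift (R a b : ℕ) : ℕ :=
  if h : ∃ k, 1 ≤ k ∧ k ≤ R ∧ (k * b + a).Coprime R then h.choose else 1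

lemma one_le_coprimeShift (R a b : ℕ) : 1 ≤ coprimeShift R a b := by
  unfold coprimeShift
  split_ifs with h
  · exact h.choose_spec.1
  · exact le_rfl

lemma coprimeShift_le {R : ℕ} (hR : 0 < R) (a b : ℕ) : coprimeShift R a b ≤ R := by
  unfold coprimeShift
  split_ifs with h
  · exact h.choose_spec.2.1
  · exact hR

lemma coprime_coprimeShift {a b R : ℕ} (hb : 0 < b) (hR : 0 < R) (h : a.Coprime b) :
    (coprimeShift R a b * b + a).Coprime R := by
  unfold coprimeShift
  rw [dif_pos (exists_coprime_mul_add hb hR h)]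
  exact (exists_coprime_mul_add hb hR h).choose_spec.2.2

/-- The digit proposed for position `2 * i + 2`. -/
noncomputable def nextDigit (R i : ℕ) (x : ℝ) : ℕ :=
  coprimeShift R (cvDen x (2 * i + 1)) (cvDen x (2 * i + 2))

/-- The denominator `q_{2 i + 2}` which results from the proposed digit. -/
noncomputable def nextDen (R i : ℕ) (x : ℝ) : ℕ :=
  nextDigit R i x * cvDen x (2 * i + 2) + cvDen x (2 * i + 1)

/-- The sum of the first `n` partial quotients. -/
noncomputable def cfSum (n : ℕ) (x : ℝ) : ℕ := ∑ m ∈ Finset.range n, cfA x (m + 1)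

lemma cfSum_congr {n : ℕ} {x y : ℝ} (h : digits n x = digits n y) : cfSum n x = cfSum n y :=
  Finset.sum_congr rfl fun i hi => digits_eq_iff.1 h i (Finset.mem_range.1 hi)

lemma cfSum_mono (x : ℝ) : Monotone fun n => cfSum n x := fun _ _ h =>
  Finset.sum_le_sum_of_subset (Finset.range_mono h)

lemma nextDigit_congr {R i : ℕ} {x y : ℝ} (h : digits (2 * i + 1) x = digits (2 * i + 1) y) :
    nextDigit R i x = nextDigit R i y := by
  obtain ⟨h1, -, h2, -⟩ := cv_congr h
  rw [nextDigit, nextDigit, h1, h2]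

lemma nextDen_congr {R i : ℕ} {x y : ℝ} (h : digits (2 * i + 1) x = digits (2 * i + 1) y) :
    nextDen R i x = nextDen R i y := by
  obtain ⟨h1, -, h2, -⟩ := cv_congr h
  rw [nextDen, nextDen, h1, h2, nextDigit_congr h]

lemma nextDen_pos {R i : ℕ} {x : ℝ} (hx : x ∈ irrUnit) : 0 < nextDen R i x := by
  have := cvDen_pos hx (2 * i)
  rw [nextDen]
  omega

lemma coprime_nextDen {R i : ℕ} (hR : 0 < R) {x : ℝ} (hx : x ∈ irrUnit) :
    (nextDen R i x).Coprime R :=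
  coprime_coprimeShift (cvDen_pos hx _) hR (coprime_cvDen x _)

lemma cvDen_eq_nextDen {R i : ℕ} {x : ℝ} (h : cfA x (2 * i + 2) = nextDigit R i x) :
    cvDen x (2 * i + 3) = nextDen R i x := by
  rw [cvDen, h, nextDen]

open Classical in
/-- Up to a constant, the conditional probability that the proposed digit is followed by a large
partial quotient, or zero if the resulting denominator belongs to `B`. -/
noncomputable def weight (R : ℕ) (B : Set ℕ) (i : ℕ) (x : ℝ) : ℝ :=
  if nextDen R i x ∈ B then 0 else 1 / (cfSum (2 * i + 1) x + R)

lemma weight_nonneg (R : ℕ) (B : Set ℕ) (i : ℕ) (x : ℝ) : 0 ≤ weight R B i x := by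
  unfold weight
  split_ifs
  · exact le_rfl
  · positivity

lemma weight_congr {R : ℕ} {B : Set ℕ} {i : ℕ} {x y : ℝ}
    (h : digits (2 * i + 1) x = digits (2 * i + 1) y) : weight R B i x = weight R B i y := by
  rw [weight, weight, nextDen_congr h, cfSum_congr h]

lemma ae_frequently_large {R K : ℕ} (hR : 0 < R) (hK : 0 < K) (B : Set ℕ) :
    ∀ᵐ x ∂irrMeasure, ¬ Summable (fun i => weight R B i x) →
      ∃ᶠ i in atTop, cfA x (2 * i + 2) = nextDigit R i x ∧ nextDen R i x ∉ B ∧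
        K * (cfSum (2 * i + 1) x + R) ≤ cfA x (2 * i + 3) := by
  set κ : ℝ := 1 / (((R : ℝ) + 1) ^ 2 * K) with hκ
  have hR' : (1 : ℝ) ≤ R := by exact_mod_cast hR
  have hK' : (1 : ℝ) ≤ K := by exact_mod_cast hK
  have hκ0 : 0 < κ := by positivity
  have hw := ae_frequently_of_not_summable (p := fun i x => κ * weight R B i x)
    (E := fun i => {x | cfA x (2 * i + 2) = nextDigit R i x ∧ nextDen R i x ∉ B ∧
        K * (cfSum (2 * i + 1) x + R) ≤ cfA x (2 * i + 3)})
    (fun i x => mul_nonneg hκ0.le (weight_nonneg _ _ _ _))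
    (fun i x y h => by rw [weight_congr h]) ?_ ?_
  · filter_upwards [hw] with x hx hns
    exact hx fun h => hns ((summable_mul_left_iff hκ0.ne').1 h)
  · intro i x y h
    have h1 := digits_mono (by omega : 2 * i + 1 ≤ 2 * i + 3) h
    have h2 := digits_eq_iff.1 h (2 * i + 1) (by omega)
    have h3 := digits_eq_iff.1 h (2 * i + 2) (by omega)
    simp only [mem_ofPred_eq]
    rw [h2, h3, nextDigit_congr h1, nextDen_congr h1, cfSum_congr h1]
  · intro i x hx
    set F := digits (2 * i + 1) ⁻¹' {digits (2 * i + 1) x} with hF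
    set E := {x | cfA x (2 * i + 2) = nextDigit R i x ∧ nextDen R i x ∉ B ∧
        K * (cfSum (2 * i + 1) x + R) ≤ cfA x (2 * i + 3)} with hE
    have hEm : MeasurableSet E := by
      refine measurableSet_of_digits (2 * i + 3) fun x y h => ?_
      have h1 := digits_mono (by omega : 2 * i + 1 ≤ 2 * i + 3) h
      have h2 := digits_eq_iff.1 h (2 * i + 1) (by omega)
      have h3 := digits_eq_iff.1 h (2 * i + 2) (by omega)
      simp only [hE, mem_ofPred_eq]
      rw [h2, h3, nextDigit_congr h1, nextDen_congr h1, cfSum_congr h1]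
    by_cases hB : nextDen R i x ∈ B
    · simp only [weight, hB, if_true, mul_zero, add_zero, ENNReal.ofReal_one, one_mul]
      exact measure_mono inter_subset_left
    set M := K * (cfSum (2 * i + 1) x + R) with hM
    have hM1 : 1 ≤ M := Nat.mul_pos hK (by omega)
    have hM1' : (1 : ℝ) ≤ M := by exact_mod_cast hM1
    have hk1 := one_le_coprimeShift R (cvDen x (2 * i + 1)) (cvDen x (2 * i + 2))
    have hk2 := coprimeShift_le hR (cvDen x (2 * i + 1)) (cvDen x (2 * i + 2))
    have hle := le_irrMeasure_fiber_inter hx (2 * i + 1) hk1 hM1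
    have hsub : F ∩ {y | cfA y (2 * i + 1 + 1) = coprimeShift R (cvDen x (2 * i + 1))
        (cvDen x (2 * i + 2)) ∧ M ≤ cfA y (2 * i + 1 + 2)} ⊆ F ∩ E := by
      rintro y ⟨hy, h1, h2⟩
      have hy' : digits (2 * i + 1) y = digits (2 * i + 1) x := hy
      refine ⟨hy, ?_, ?_, ?_⟩
      · rw [nextDigit_congr hy']
        exact h1
      · rwa [nextDen_congr hy']
      · rw [cfSum_congr hy']
        exact h2
    have hw1 : κ * weight R B i x ≤
        1 / (((coprimeShift R (cvDen x (2 * i + 1)) (cvDen x (2 * i + 2)) : ℕ) + 1 : ℝ) ^ 2 * M) := by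
      rw [weight, if_neg hB, hκ, div_mul_div_comm, hM]
      push_cast
      rw [mul_one, mul_assoc]
      have hk2' : ((coprimeShift R (cvDen x (2 * i + 1)) (cvDen x (2 * i + 2)) : ℕ) : ℝ) ≤ R := by
        exact_mod_cast hk2
      gcongr
    have hEF : ENNReal.ofReal (κ * weight R B i x) * irrMeasure F ≤ irrMeasure (F ∩ E) :=
      (mul_le_mul_left (ENNReal.ofReal_le_ofReal hw1) _).trans (hle.trans (measure_mono hsub))
    have hsplit := measure_inter_add_sdiff (μ := irrMeasure) F hEm
    have hr0 : 0 ≤ κ * weight R B i x := mul_nonneg hκ0.le (weight_nonneg _ _ _ _)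
    rw [← sdiff_eq, ENNReal.ofReal_add zero_le_one hr0, ENNReal.ofReal_one, add_mul, one_mul]
    calc irrMeasure (F \ E) + ENNReal.ofReal (κ * weight R B i x) * irrMeasure (F \ E)
        ≤ irrMeasure (F \ E) + irrMeasure (F ∩ E) := by
          gcongr
          exact (mul_le_mul_right (measure_mono sdiff_subset) _).trans hEF
      _ = irrMeasure F := by rw [add_comm, hsplit]

lemma sum_inv_Icc_le (n : ℕ) : ∑ m ∈ Finset.Icc 1 n, (1 : ℝ) / m ≤ 1 + Real.log n := by
  have h := harmonic_le_one_add_log n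
  rw [harmonic_eq_sum_Icc] at h
  push_cast at h
  simpa [one_div] using h

lemma sum_inv_le_of_gap {s : Finset ℕ} {g Q : ℕ} (hg : 0 < g) (hQ : ∀ q ∈ s, q ≤ Q)
    (hmin : ∀ q ∈ s, g ≤ q) (hgap : ∀ q ∈ s, ∀ q' ∈ s, q < q' → q + g ≤ q') :
    ∑ q ∈ s, (1 : ℝ) / q ≤ 1 / g * (1 + Real.log Q) := by
  have hinj : Set.InjOn (fun q => q / g) (s : Set ℕ) := by
    have aux : ∀ q ∈ s, ∀ q' ∈ s, q < q' → q / g ≠ q' / g := fun q hq q' hq' h => by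
      have := Nat.div_le_div_right (c := g) (hgap q hq q' hq' h)
      rw [Nat.add_div_right _ hg] at this
      omega
    intro q hq q' hq' h
    rcases lt_trichotomy q q' with h1 | h1 | h1
    · exact absurd h (aux q hq q' hq' h1)
    · exact h1
    · exact absurd h.symm (aux q' hq' q hq h1)
  have h1 : ∀ q ∈ s, (1 : ℝ) / q ≤ 1 / g * (1 / ((q / g : ℕ) : ℝ)) := fun q hq => by
    have h2 : 0 < q / g := Nat.div_pos (hmin q hq) hg
    have h3 : ((g * (q / g) : ℕ) : ℝ) ≤ q := by exact_mod_cast Nat.mul_div_le q g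
    push_cast at h3
    rw [div_mul_div_comm, one_mul]
    have : (0 : ℝ) < g * ((q / g : ℕ) : ℝ) := by positivity
    gcongr
  calc ∑ q ∈ s, (1 : ℝ) / q ≤ ∑ q ∈ s, 1 / g * (1 / ((q / g : ℕ) : ℝ)) := Finset.sum_le_sum h1
    _ = 1 / g * ∑ m ∈ s.image (fun q => q / g), 1 / (m : ℝ) := by
        rw [← Finset.mul_sum, Finset.sum_image hinj]
    _ ≤ 1 / g * ∑ m ∈ Finset.Icc 1 Q, 1 / (m : ℝ) := by
        gcongr
        intro m hm
        obtain ⟨q, hq, rfl⟩ := Finset.mem_image.1 hm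
        exact Finset.mem_Icc.2 ⟨Nat.div_pos (hmin q hq) hg, (Nat.div_le_self q g).trans (hQ q hq)⟩
    _ ≤ 1 / g * (1 + Real.log Q) := by
        gcongr
        exact sum_inv_Icc_le Q

/-- The harmonic sum over the elements of `B` up to `Q` is at most `η * (1 + log Q)`. -/
def LogSparse (η : ℝ) (B : Set ℕ) : Prop :=
  ∀ (s : Finset ℕ) (Q : ℕ), (∀ q ∈ s, 1 ≤ q ∧ q ≤ Q ∧ q ∈ B) →
    ∑ q ∈ s, (1 : ℝ) / q ≤ η * (1 + Real.log Q)

lemma exists_logSparse {β : UnitAddCircle} (hβ : ¬ IsOfFinAddOrder β) {η : ℝ} (hη : 0 < η) :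
    ∃ c > 0, LogSparse η {q | ‖q • β‖ < c} := by
  obtain ⟨g, hg⟩ := exists_nat_gt (1 / η)
  have hg0 : 0 < g := by
    have : (0 : ℝ) < g := lt_trans (by positivity) hg
    exact_mod_cast this
  have hpos : ∀ r ∈ Finset.Icc 1 g, 0 < ‖r • β‖ := fun r hr => by
    rw [norm_pos_iff]
    intro h
    exact hβ (isOfFinAddOrder_iff_nsmul_eq_zero.2 ⟨r, (Finset.mem_Icc.1 hr).1, h⟩)
  obtain ⟨r₀, hr₀, hmin⟩ := Finset.exists_min_image (Finset.Icc 1 g) (fun r => ‖r • β‖)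
    ⟨1, Finset.mem_Icc.2 ⟨le_rfl, hg0⟩⟩
  have hc := hpos r₀ hr₀
  refine ⟨‖r₀ • β‖ / 2, by linarith, fun s Q hs => ?_⟩
  have hfar : ∀ r, 1 ≤ r → ‖r • β‖ < ‖r₀ • β‖ → g < r := fun r h1 h2 => by
    by_contra! h3
    exact absurd (hmin r (Finset.mem_Icc.2 ⟨h1, h3⟩)) (not_le.2 h2)
  refine (sum_inv_le_of_gap hg0 (fun q hq => (hs q hq).2.1)
    (fun q hq => (hfar q (hs q hq).1 (by linarith [(hs q hq).2.2.out])).le) ?_).trans ?_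
  · intro q hq q' hq' hlt
    have h1 : (q' - q) • β = q' • β - q • β := by
      rw [sub_nsmul β hlt.le, sub_eq_add_neg]
    have h2 : ‖(q' - q) • β‖ < ‖r₀ • β‖ := by
      rw [h1]
      linarith [norm_sub_le (q' • β) (q • β), (hs q hq).2.2.out, (hs q' hq').2.2.out]
    have := hfar (q' - q) (by omega) h2
    omega
  · have hl : 0 ≤ 1 + Real.log Q := by linarith [Real.log_natCast_nonneg Q]
    have : (1 : ℝ) / g ≤ η := by
      rw [div_le_iff₀ (by exact_mod_cast hg0)]
      rw [div_lt_iff₀ hη] at hg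
      linarith
    gcongr

lemma exists_logSparse_exists {ι : Type*} [Finite ι] {β : ι → UnitAddCircle}
    (hβ : ∀ j, ¬ IsOfFinAddOrder (β j)) {η : ℝ} (hη : 0 < η) :
    ∃ c > 0, LogSparse η {q | ∃ j, ‖q • β j‖ < c} := by
  classical
  have := Fintype.ofFinite ι
  choose c hc h using fun j => exists_logSparse (hβ j)
    (div_pos hη (by positivity : (0 : ℝ) < Fintype.card ι + 1))
  obtain ⟨c₀, hc₀, hle⟩ : ∃ c₀ > 0, ∀ j, c₀ ≤ c j := by
    rcases isEmpty_or_nonempty ι with h0 | h0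
    · exact ⟨1, one_pos, fun j => h0.elim j⟩
    · obtain ⟨j₀, hj₀⟩ := Finite.exists_min c
      exact ⟨c j₀, hc j₀, hj₀⟩
  refine ⟨c₀, hc₀, fun s Q hs => ?_⟩
  have hl : 0 ≤ 1 + Real.log Q := by linarith [Real.log_natCast_nonneg Q]
  calc ∑ q ∈ s, (1 : ℝ) / q
      ≤ ∑ q ∈ s, ∑ j, if ‖q • β j‖ < c₀ then (1 : ℝ) / q else 0 := by
        refine Finset.sum_le_sum fun q hq => ?_
        obtain ⟨j, hj⟩ := (hs q hq).2.2
        refine le_trans ?_ (Finset.single_le_sum (f := fun j =>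
          if ‖q • β j‖ < c₀ then (1 : ℝ) / q else 0)
          (fun i _ => by split_ifs <;> positivity) (Finset.mem_univ j))
        simp [hj]
    _ = ∑ j, ∑ q ∈ s with ‖q • β j‖ < c₀, (1 : ℝ) / q := by
        rw [Finset.sum_comm]
        simp_rw [Finset.sum_filter]
    _ ≤ ∑ _j : ι, η / (Fintype.card ι + 1) * (1 + Real.log Q) := by
        refine Finset.sum_le_sum fun j _ => h j _ Q fun q hq => ?_
        obtain ⟨h1, h2⟩ := Finset.mem_filter.1 hq
        exact ⟨(hs q h1).1, (hs q h1).2.1, h2.trans_le (hle j)⟩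
    _ = Fintype.card ι / (Fintype.card ι + 1) * (η * (1 + Real.log Q)) := by
        rw [Finset.sum_const, nsmul_eq_mul, Finset.card_univ]
        ring
    _ ≤ η * (1 + Real.log Q) := by
        refine mul_le_of_le_one_left (by positivity) ?_
        rw [div_le_one (by positivity)]
        linarith

/-- Markov's inequality for a finite sum of weighted indicators. -/
lemma measure_le_sum_indicator_le {ι : Type*} {s : Finset ι} {w : ι → ℝ} (hw : ∀ i, 0 ≤ w i)
    {S : ι → Set ℝ} (hS : ∀ i, MeasurableSet (S i)) {C l : ℝ} (hl : 0 < l)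
    (h : ∑ i ∈ s, ENNReal.ofReal (w i) * irrMeasure (S i) ≤ ENNReal.ofReal C) :
    irrMeasure {x | l ≤ ∑ i ∈ s, (S i).indicator (fun _ => w i) x} ≤ ENNReal.ofReal (C / l) := by
  have h0 : ∀ i x, 0 ≤ (S i).indicator (fun _ => w i) x := fun i x =>
    indicator_nonneg (fun _ _ => hw i) x
  have h1 : ∫⁻ x, ENNReal.ofReal (∑ i ∈ s, (S i).indicator (fun _ => w i) x) ∂irrMeasure
      ≤ ENNReal.ofReal C := by
    refine le_trans (le_of_eq ?_) h
    simp_rw [ENNReal.ofReal_sum_of_nonneg fun i _ => h0 i _]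
    rw [lintegral_finsetSum]
    · refine Finset.sum_congr rfl fun i _ => ?_
      have : ∀ x, ENNReal.ofReal ((S i).indicator (fun _ => w i) x) =
          (S i).indicator (fun _ => ENNReal.ofReal (w i)) x := fun x => by
        by_cases hx : x ∈ S i <;> simp [hx]
      simp_rw [this]
      rw [lintegral_indicator (hS i), setLIntegral_const]
    · intro i _
      exact (measurable_const.indicator (hS i)).ennreal_ofReal
  have hm : Measurable fun x => ENNReal.ofReal (∑ i ∈ s, (S i).indicator (fun _ => w i) x) :=
    (Finset.measurable_sum _ fun i _ => measurable_const.indicator (hS i)).ennreal_ofReal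
  have h2 := meas_ge_le_lintegral_div (μ := irrMeasure) hm.aemeasurable
    (ε := ENNReal.ofReal l) (by simpa using hl) ENNReal.ofReal_ne_top
  rw [ENNReal.ofReal_div_of_pos hl]
  refine le_trans (measure_mono fun x hx => ?_) (h2.trans (by gcongr))
  exact ENNReal.ofReal_le_ofReal hx

lemma irrMeasure_cvDen_eq_le {q : ℕ} (hq : 0 < q) :
    irrMeasure {x | ∃ n, cvDen x (n + 1) = q} ≤ ENNReal.ofReal (4 / q) := by
  have hq' : (1 : ℝ) ≤ q := by exact_mod_cast hq
  have hsub : {x | ∃ n, cvDen x (n + 1) = q} ∩ irrUnit ⊆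
      ⋃ p ∈ Finset.range (q + 1), Icc ((p : ℝ) / q - 1 / (q : ℝ) ^ 2) (p / q + 1 / (q : ℝ) ^ 2) := by
    rintro x ⟨⟨n, rfl⟩, hx⟩
    have h := cvDen_mul_sub_cvNum hx n
    have ht := (gaussIter_mem hx n).2
    set t := gaussIter x n with ht'
    set Q : ℝ := ((cvDen x (n + 1) : ℕ) : ℝ) with hQ
    set P : ℝ := ((cvDen x n : ℕ) : ℝ) with hP
    have hP0 : 0 ≤ P := Nat.cast_nonneg _
    have habs : |Q * x - cvNum x (n + 1)| ≤ 1 / Q := by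
      rw [h, abs_div, abs_mul, abs_pow, abs_neg, abs_one, one_pow, one_mul, abs_of_pos ht.1,
        abs_of_pos (add_pos_of_pos_of_nonneg (by linarith) (mul_nonneg ht.1.le hP0))]
      rw [div_le_div_iff₀ (add_pos_of_pos_of_nonneg (by linarith) (mul_nonneg ht.1.le hP0))
        (by linarith)]
      nlinarith [mul_nonneg ht.1.le hP0, ht.2]
    have habs' : |x - cvNum x (n + 1) / Q| ≤ 1 / Q ^ 2 := by
      have : x - cvNum x (n + 1) / Q = (Q * x - cvNum x (n + 1)) / Q := by
        field_simp
      rw [this, abs_div, abs_of_pos (by linarith : 0 < Q), sq, ← div_div]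
      gcongr
    have hp : cvNum x (n + 1) < cvDen x (n + 1) + 1 := by
      have h1 : (1 : ℝ) / Q ≤ 1 := by rw [div_le_one (by linarith)]; exact hq'
      have h2 : (cvNum x (n + 1) : ℝ) < cvDen x (n + 1) + 1 := by
        have := (abs_le.1 habs).1
        have : Q * x < Q * 1 := by
          have := hx.2.2
          gcongr
        linarith
      exact_mod_cast h2
    simp only [mem_iUnion]
    refine ⟨cvNum x (n + 1), Finset.mem_range.2 hp, ?_⟩
    rw [abs_le] at habs'
    exact ⟨by linarith [habs'.1], by linarith [habs'.2]⟩
  rw [irrMeasure_apply]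
  refine (measure_mono hsub).trans ((measure_biUnion_finset_le _ _).trans ?_)
  simp only [Real.volume_Icc]
  rw [← ENNReal.ofReal_sum_of_nonneg fun i _ => by
    rw [add_sub_sub_cancel]
    positivity]
  apply ENNReal.ofReal_le_ofReal
  simp only [add_sub_sub_cancel, Finset.sum_const, Finset.card_range, nsmul_eq_mul]
  push_cast
  rw [← add_div, mul_div_assoc', div_le_div_iff₀ (by positivity) (by positivity)]
  nlinarith [mul_nonneg (by linarith : (0 : ℝ) ≤ q) (by linarith : (0 : ℝ) ≤ (q : ℝ) - 1)]

lemma irrMeasure_nextDen_le {R : ℕ} (hR : 0 < R) (B : Set ℕ) (i : ℕ) :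
    irrMeasure {x | nextDen R i x ∈ B} ≤
      ENNReal.ofReal (((R : ℝ) + 1) ^ 2) * irrMeasure {x | cvDen x (2 * i + 3) ∈ B} := by
  set A := {x | cfA x (2 * i + 2) = nextDigit R i x} with hA
  have hAm : MeasurableSet A := measurableSet_of_digits (2 * i + 2) fun x y h => by
    simp only [hA, mem_ofPred_eq]
    rw [digits_eq_iff.1 h (2 * i + 1) (by omega),
      nextDigit_congr (digits_mono (by omega : 2 * i + 1 ≤ 2 * i + 2) h)]
  have hBm : MeasurableSet {x | nextDen R i x ∈ B} :=
    measurableSet_of_digits (2 * i + 1) fun x y h => by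
      simp only [mem_ofPred_eq]
      rw [nextDen_congr h]
  have hc : ∀ x y, digits (2 * i + 1) x = digits (2 * i + 1) y →
      {x | nextDen R i x ∈ B}.indicator (1 : ℝ → ENNReal) x =
        {x | nextDen R i x ∈ B}.indicator (1 : ℝ → ENNReal) y := fun x y h => by
    change B.indicator (1 : ℕ → ENNReal) (nextDen R i x) = B.indicator 1 (nextDen R i y)
    rw [nextDen_congr h]
  have h := lintegral_le_of_digits (n := 2 * i + 1) (m₁ := irrMeasure)
    (m₂ := irrMeasure.restrict A) irrMeasure_compl
    (u := {x | nextDen R i x ∈ B}.indicator 1)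
    (v := fun x => {x | nextDen R i x ∈ B}.indicator 1 x * ENNReal.ofReal (((R : ℝ) + 1) ^ 2))
    hc (fun x y h => by rw [hc x y h]) ?_
  · rw [lintegral_mul_const _ (measurable_one.indicator hBm), lintegral_indicator_one hBm,
      lintegral_indicator_one hBm, Measure.restrict_apply hBm, mul_comm] at h
    refine h.trans ?_
    gcongr
    rintro x ⟨h1, h2⟩
    rw [mem_ofPred_eq, cvDen_eq_nextDen h2]
    exact h1
  · intro x hx
    rw [mul_assoc]
    gcongr
    have hk1 := one_le_coprimeShift R (cvDen x (2 * i + 1)) (cvDen x (2 * i + 2))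
    have hk2 := coprimeShift_le hR (cvDen x (2 * i + 1)) (cvDen x (2 * i + 2))
    have hle := le_irrMeasure_fiber_inter hx (2 * i + 1) hk1 le_rfl
    have hsub : digits (2 * i + 1) ⁻¹' {digits (2 * i + 1) x} ∩ {y | cfA y (2 * i + 1 + 1) =
        coprimeShift R (cvDen x (2 * i + 1)) (cvDen x (2 * i + 2)) ∧ 1 ≤ cfA y (2 * i + 1 + 2)} ⊆
        digits (2 * i + 1) ⁻¹' {digits (2 * i + 1) x} ∩ A := by
      rintro y ⟨hy, h1, -⟩
      have hy' : digits (2 * i + 1) y = digits (2 * i + 1) x := hy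
      refine ⟨hy, ?_⟩
      simp only [hA, mem_ofPred_eq]
      rw [nextDigit_congr hy']
      exact h1
    rw [Measure.restrict_apply' hAm]
    refine le_trans ?_ (mul_le_mul_right (hle.trans (measure_mono hsub)) _)
    rw [← mul_assoc, ← ENNReal.ofReal_mul (by positivity)]
    refine le_mul_of_one_le_left zero_le (ENNReal.one_le_ofReal.2 ?_)
    have : ((coprimeShift R (cvDen x (2 * i + 1)) (cvDen x (2 * i + 2)) : ℕ) : ℝ) ≤ R := by
      exact_mod_cast hk2
    rw [Nat.cast_one, mul_one, mul_one_div, le_div_iff₀ (by positivity), one_mul]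
    gcongr

lemma sum_irrMeasure_nextDen_le {R : ℕ} (hR : 0 < R) {B : Set ℕ} {η : ℝ}
    (hB : LogSparse η B) (s : Finset ℕ) (Q : ℕ) :
    ∑ i ∈ s, irrMeasure {x | nextDen R i x ∈ B ∩ Icc 1 Q} ≤
      ENNReal.ofReal (((R : ℝ) + 1) ^ 2 * (4 * (η * (1 + Real.log Q)))) := by
  classical
  set t := (Finset.Icc 1 Q).filter (· ∈ B) with ht
  have htB : ∀ q, q ∈ B ∩ Icc 1 Q ↔ q ∈ t := fun q => by
    simp [ht, and_comm]
  have h1 : ∀ i, irrMeasure {x | cvDen x (2 * i + 3) ∈ B ∩ Icc 1 Q} ≤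
      ∑ q ∈ t, irrMeasure ({x | cvDen x (2 * i + 3) = q} ∩ irrUnit) := fun i => by
    rw [irrMeasure_apply]
    refine le_trans ?_ (measure_biUnion_finset_le _ _)
    rw [irrMeasure_apply]
    refine measure_mono ?_
    rintro x ⟨hx, hx'⟩
    refine ⟨?_, hx'⟩
    simp only [mem_iUnion]
    exact ⟨_, (htB _).1 hx, rfl, hx'⟩
  have h2 : ∀ q ∈ t, ∑ i ∈ s, irrMeasure ({x | cvDen x (2 * i + 3) = q} ∩ irrUnit) ≤
      ENNReal.ofReal (4 / q) := fun q hq => by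
    rw [← measure_biUnion_finset]
    · refine le_trans (measure_mono ?_)
        (irrMeasure_cvDen_eq_le (Finset.mem_Icc.1 (Finset.mem_filter.1 hq).1).1)
      intro x hx
      simp only [mem_iUnion] at hx
      obtain ⟨i, -, hi, -⟩ := hx
      exact ⟨2 * i + 2, hi⟩
    · intro i _ j _ hij
      refine Set.disjoint_left.2 ?_
      rintro x ⟨h3, hx⟩ ⟨h4, -⟩
      have := (cvDen_strictMono hx).injective
        (show cvDen x (2 * i + 1 + 2) = cvDen x (2 * j + 1 + 2) from h3.trans h4.symm)
      omega
    · intro i _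
      refine MeasurableSet.inter ?_ measurableSet_irrUnit
      refine measurableSet_of_digits (2 * i + 2) fun x y h => ?_
      rw [mem_ofPred_eq, mem_ofPred_eq, (cv_congr h).1]
  calc _ ≤ ∑ i ∈ s, ENNReal.ofReal (((R : ℝ) + 1) ^ 2) *
        ∑ q ∈ t, irrMeasure ({x | cvDen x (2 * i + 3) = q} ∩ irrUnit) :=
        Finset.sum_le_sum fun i _ => (irrMeasure_nextDen_le hR _ i).trans (by gcongr; exact h1 i)
    _ = ENNReal.ofReal (((R : ℝ) + 1) ^ 2) *
        ∑ q ∈ t, ∑ i ∈ s, irrMeasure ({x | cvDen x (2 * i + 3) = q} ∩ irrUnit) := by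
        rw [← Finset.mul_sum, Finset.sum_comm]
    _ ≤ ENNReal.ofReal (((R : ℝ) + 1) ^ 2) * ∑ q ∈ t, ENNReal.ofReal (4 / q) := by
        gcongr with q hq
        exact h2 q hq
    _ ≤ _ := by
        rw [← ENNReal.ofReal_sum_of_nonneg fun i _ => by positivity,
          ← ENNReal.ofReal_mul (by positivity)]
        apply ENNReal.ofReal_le_ofReal
        gcongr
        have := hB t Q fun q hq => by
          obtain ⟨h3, h4⟩ := (htB q).2 hq
          exact ⟨h4.1, h4.2, h3⟩
        calc ∑ q ∈ t, (4 : ℝ) / q = 4 * ∑ q ∈ t, (1 : ℝ) / q := by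
              rw [Finset.mul_sum]
              exact Finset.sum_congr rfl fun q _ => by ring
          _ ≤ _ := by gcongr

lemma irrMeasure_trunc_le {w : ℕ → ℝ} (hw : ∀ m, 0 ≤ w m) (n M : ℕ) {l : ℝ} (hl : 0 < l) :
    irrMeasure {x | l ≤ ∑ i ∈ Finset.range n, ∑ m ∈ Finset.Icc 1 M,
      if m ≤ cfA x (i + 1) then w m else 0} ≤
        ENNReal.ofReal (n * (∑ m ∈ Finset.Icc 1 M, w m * (2 / m)) / l) := by
  have h := measure_le_sum_indicator_le (s := Finset.range n ×ˢ Finset.Icc 1 M)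
    (w := fun i => w i.2) (S := fun i => {x | i.2 ≤ cfA x (i.1 + 1)})
    (C := n * (∑ m ∈ Finset.Icc 1 M, w m * (2 / m))) (fun i => hw i.2) ?_ hl ?_
  · simp only [Finset.sum_product, indicator, mem_ofPred_eq] at h
    exact h
  · intro i
    refine measurableSet_of_digits (i.1 + 1) fun x y h => ?_
    rw [mem_ofPred_eq, mem_ofPred_eq, digits_eq_iff.1 h i.1 i.1.lt_succ_self]
  · have h0 : ∀ m, 0 ≤ w m * (2 / m) := fun m => mul_nonneg (hw m) (by positivity)
    rw [Finset.sum_product, ← nsmul_eq_mul, ENNReal.ofReal_nsmul,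
      ENNReal.ofReal_sum_of_nonneg fun m _ => h0 m, nsmul_eq_mul, ← nsmul_eq_mul]
    refine (Finset.sum_le_card_nsmul _ _ _ fun i _ => ?_).trans (by rw [Finset.card_range])
    refine Finset.sum_le_sum fun m hm => ?_
    rw [ENNReal.ofReal_mul (hw m)]
    gcongr
    exact irrMeasure_le_cfA i (Finset.mem_Icc.1 hm).1

lemma cvDen_le_prod {x : ℝ} (hx : x ∈ irrUnit) (n : ℕ) :
    cvDen x (n + 1) ≤ ∏ i ∈ Finset.range n, (cfA x (i + 1) + 1) := by
  induction n with
  | zero => simp [cvDen]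
  | succ n ih =>
    rw [Finset.prod_range_succ, cvDen]
    have := cvDen_le_succ hx n
    nlinarith

lemma cvDen_le_exp {x : ℝ} (hx : x ∈ irrUnit) (n : ℕ) :
    (cvDen x (n + 1) : ℝ) ≤
      Real.exp (∑ i ∈ Finset.range n, ∑ m ∈ Finset.Icc 1 (cfA x (i + 1)), (1 : ℝ) / m) := by
  rw [Real.exp_sum]
  calc (cvDen x (n + 1) : ℝ) ≤ ∏ i ∈ Finset.range n, ((cfA x (i + 1) : ℝ) + 1) := by
        exact_mod_cast cvDen_le_prod hx n
    _ ≤ _ := by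
        refine Finset.prod_le_prod (fun i _ => by positivity) fun i _ => ?_
        rw [← Real.log_le_iff_le_exp (by positivity)]
        have h := log_add_one_le_harmonic (cfA x (i + 1))
        rw [harmonic_eq_sum_Icc] at h
        push_cast at h
        simpa [one_div] using h

lemma sum_ite_le_eq {a M : ℕ} (h : a ≤ M) (w : ℕ → ℝ) :
    ∑ m ∈ Finset.Icc 1 M, (if m ≤ a then w m else 0) = ∑ m ∈ Finset.Icc 1 a, w m := by
  rw [← Finset.sum_filter]
  congr 1
  ext m
  simp only [Finset.mem_filter, Finset.mem_Icc]
  omega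

lemma sum_inv_sq_Icc_le (M : ℕ) : ∑ m ∈ Finset.Icc 1 M, (1 : ℝ) / m * (2 / m) ≤ 4 - 2 / M := by
  induction M with
  | zero => norm_num
  | succ M ih =>
    rw [Finset.sum_Icc_succ_top (by omega)]
    rcases Nat.eq_zero_or_pos M with rfl | hM
    · norm_num
    · have hM' : (0 : ℝ) < M := by exact_mod_cast hM
      have : (1 : ℝ) / ((M + 1 : ℕ) : ℝ) * (2 / ((M + 1 : ℕ) : ℝ)) ≤
          2 / M - 2 / ((M + 1 : ℕ) : ℝ) := by
        push_cast
        rw [div_sub_div _ _ (by positivity) (by positivity), div_mul_div_comm,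
          div_le_div_iff₀ (by positivity) (by positivity)]
        nlinarith
      linarith

open Classical in
/-- A lower bound for the total weight of a block, under bounds for the digits and for the number
of denominators in `B`. -/
lemma le_sum_weight {R N j Q : ℕ} (hN : 0 < N) (hR : 0 < R) {B : Set ℕ} {C D : ℝ}
    (hC : 0 < C) {x : ℝ} (hx : x ∈ irrUnit) (hsum : (cfSum (4 * N) x : ℝ) ≤ C * (N * (j + 1)))
    (hlog : ∑ i ∈ Finset.range (4 * N), ∑ m ∈ Finset.Icc 1 (cfA x (i + 1)), (1 : ℝ) / m ≤ D)
    (hQ : ((R : ℝ) + 1) * Real.exp D < Q + 1)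
    (hbad : ∑ i ∈ Finset.Ico N (2 * N), (if nextDen R i x ∈ B ∩ Icc 1 Q then (1 : ℝ) else 0)
      ≤ N / 2) :
    1 / (2 * (C + R)) / (j + 1) ≤ ∑ i ∈ Finset.Ico N (2 * N), weight R B i x := by
  have hN' : (1 : ℝ) ≤ N := by exact_mod_cast hN
  have hR' : (1 : ℝ) ≤ R := by exact_mod_cast hR
  have hT : 0 < C * (N * (j + 1)) + R := by positivity
  have hterm : ∀ i ∈ Finset.Ico N (2 * N),
      (1 - (if nextDen R i x ∈ B ∩ Icc 1 Q then (1 : ℝ) else 0)) *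
        (1 / (C * (N * (j + 1)) + R)) ≤ weight R B i x := by
    intro i hi
    have hi2 : 2 * i + 1 ≤ 4 * N := by have := (Finset.mem_Ico.1 hi).2; omega
    have hQ' : nextDen R i x ≤ Q := by
      have h1 : cvDen x (2 * i + 1) ≤ cvDen x (2 * i + 2) := cvDen_le_succ hx _
      have hk : nextDigit R i x ≤ R := coprimeShift_le hR _ _
      have h2 : nextDen R i x ≤ (R + 1) * cvDen x (2 * i + 2) := by
        rw [nextDen]
        nlinarith
      have h3 : (nextDen R i x : ℝ) ≤ (R + 1) * cvDen x (2 * i + 2) := by exact_mod_cast h2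
      have h4 : (cvDen x (2 * i + 2) : ℝ) ≤ Real.exp D := by
        refine (cvDen_le_exp hx (2 * i + 1)).trans (Real.exp_le_exp.2 (le_trans ?_ hlog))
        exact Finset.sum_le_sum_of_subset_of_nonneg (Finset.range_mono hi2) fun _ _ _ => by
          positivity
      have h5 : (nextDen R i x : ℝ) < (Q + 1 : ℕ) := by
        push_cast
        refine lt_of_le_of_lt (h3.trans ?_) hQ
        gcongr
      exact Nat.lt_succ_iff.1 (by exact_mod_cast h5)
    by_cases hB : nextDen R i x ∈ B
    · have : nextDen R i x ∈ B ∩ Icc 1 Q := ⟨hB, nextDen_pos hx, hQ'⟩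
      rw [if_pos this, sub_self, zero_mul]
      exact weight_nonneg _ _ _ _
    · rw [if_neg fun h => hB h.1, weight, if_neg hB, sub_zero, one_mul]
      have h1 : (cfSum (2 * i + 1) x : ℝ) ≤ C * (N * (j + 1)) :=
        le_trans (by exact_mod_cast cfSum_mono x hi2) hsum
      gcongr
  refine le_trans ?_ (Finset.sum_le_sum hterm)
  rw [← Finset.sum_mul, Finset.sum_sub_distrib]
  have hcard : ∑ _i ∈ Finset.Ico N (2 * N), (1 : ℝ) = N := by
    simp only [Finset.sum_const, Nat.card_Ico, nsmul_eq_mul, mul_one]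
    congr 1
    omega
  rw [hcard]
  calc 1 / (2 * (C + R)) / ((j : ℝ) + 1) ≤ (N / 2) * (1 / (C * (N * (j + 1)) + R)) := by
        rw [div_div, div_mul_div_comm, mul_one, div_le_div_iff₀ (by positivity) (by positivity)]
        have : (R : ℝ) ≤ R * (N * (j + 1)) := by
          have : (1 : ℝ) ≤ N * (j + 1) := by nlinarith [(Nat.cast_nonneg j : (0 : ℝ) ≤ j)]
          nlinarith
        nlinarith
    _ ≤ _ := by
        gcongr
        linarith

/-- Off a set of small measure, every dyadic block has a large total weight. -/
lemma exists_block_bound {R : ℕ} (hR : 0 < R) {ε : ℝ} (hε : 0 < ε) :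
    ∃ η > 0, ∃ τ > 0, ∀ B : Set ℕ, LogSparse η B → ∀ j : ℕ,
      irrMeasure {x | ∑ i ∈ Finset.Ico (2 ^ j) (2 * 2 ^ j), weight R B i x < τ / (j + 1)} ≤
        ENNReal.ofReal (4 * ε) := by
  classical
  have hR' : (1 : ℝ) ≤ R := by exact_mod_cast hR
  obtain ⟨b, hb⟩ := pow_unbounded_of_one_lt (8 / ε) (one_lt_two : (1 : ℝ) < 2)
  set C : ℝ := 8 * (1 + b) / ε with hC
  have hC0 : 0 < C := by positivity
  set D : ℝ := 16 / ε with hD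
  have hD0 : 0 < D := by positivity
  have hlogR : 0 ≤ Real.log (R + 1) := Real.log_nonneg (by linarith)
  set G : ℝ := 1 + Real.log (R + 1) + D with hG
  have hG0 : 0 < G := by positivity
  refine ⟨ε / (8 * ((R : ℝ) + 1) ^ 2 * G), by positivity, 1 / (2 * (C + R)), by positivity,
    fun B hB j => ?_⟩
  set N : ℕ := 2 ^ j with hN
  have hN0 : 0 < N := by positivity
  have hN' : (1 : ℝ) ≤ N := by exact_mod_cast hN0
  set M : ℕ := 2 ^ (j + b) with hM
  have hM0 : 0 < M := by positivity
  set Q : ℕ := ⌊((R : ℝ) + 1) * Real.exp (D * N)⌋₊ with hQ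
  have hQ1 : (1 : ℝ) ≤ (R + 1) * Real.exp (D * N) := by
    have : (1 : ℝ) ≤ Real.exp (D * N) := Real.one_le_exp (by positivity)
    nlinarith
  have hQ0 : 0 < Q := Nat.floor_pos.2 hQ1
  have hlogQ : 1 + Real.log Q ≤ G * N := by
    have h1 : Real.log Q ≤ Real.log (R + 1) + D * N := by
      rw [← Real.log_exp (D * N), ← Real.log_mul (by positivity) (by positivity)]
      exact Real.log_le_log (by exact_mod_cast hQ0) (Nat.floor_le (by positivity))
    rw [hG]
    nlinarith
  set S1 := {x : ℝ | ∃ i < 4 * N, M ≤ cfA x (i + 1)} with hS1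
  set S2 := {x : ℝ | C * (N * (j + 1)) ≤ ∑ i ∈ Finset.range (4 * N), ∑ m ∈ Finset.Icc 1 M,
    if m ≤ cfA x (i + 1) then (1 : ℝ) else 0} with hS2
  set S3 := {x : ℝ | D * N ≤ ∑ i ∈ Finset.range (4 * N), ∑ m ∈ Finset.Icc 1 M,
    if m ≤ cfA x (i + 1) then (1 : ℝ) / m else 0} with hS3
  set S4 := {x : ℝ | (N : ℝ) / 2 ≤ ∑ i ∈ Finset.Ico N (2 * N),
    {x | nextDen R i x ∈ B ∩ Icc 1 Q}.indicator (fun _ => (1 : ℝ)) x} with hS4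
  have m1 : irrMeasure S1 ≤ ENNReal.ofReal ε := by
    have : S1 = ⋃ i ∈ Finset.range (4 * N), {x : ℝ | M ≤ cfA x (i + 1)} := by
      ext x
      simp [hS1]
    rw [this]
    refine (measure_biUnion_finset_le _ _).trans ?_
    refine (Finset.sum_le_card_nsmul _ _ _ fun i _ => irrMeasure_le_cfA i hM0).trans ?_
    rw [← ENNReal.ofReal_nsmul, Finset.card_range]
    apply ENNReal.ofReal_le_ofReal
    rw [hM, hN, nsmul_eq_mul, mul_div_assoc', div_le_iff₀ (by positivity)]
    push_cast
    rw [div_lt_iff₀ hε] at hb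
    rw [pow_add]
    have : (0 : ℝ) < 2 ^ j := by positivity
    nlinarith
  have m2 : irrMeasure S2 ≤ ENNReal.ofReal ε := by
    refine (irrMeasure_trunc_le (w := fun _ => 1) (fun _ => zero_le_one) (4 * N) M
      (by positivity)).trans (ENNReal.ofReal_le_ofReal ?_)
    have h1 : ∑ m ∈ Finset.Icc 1 M, (1 : ℝ) * (2 / m) ≤ 2 * ((1 + b) * (j + 1)) := by
      have h2 : ∑ m ∈ Finset.Icc 1 M, (1 : ℝ) * (2 / m) =
          2 * ∑ m ∈ Finset.Icc 1 M, (1 : ℝ) / m := by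
        rw [Finset.mul_sum]
        exact Finset.sum_congr rfl fun m _ => by ring
      have h3 := sum_inv_Icc_le M
      have h4 : Real.log M ≤ j + b := by
        rw [hM]
        push_cast
        rw [Real.log_pow]
        push_cast
        have := Real.log_two_lt_d9
        nlinarith [(by positivity : (0 : ℝ) ≤ j + b)]
      rw [h2]
      nlinarith [(by positivity : (0 : ℝ) ≤ b * j)]
    rw [div_le_iff₀ (by positivity)]
    calc _ ≤ ((4 * N : ℕ) : ℝ) * (2 * ((1 + b) * (j + 1))) := by gcongr
      _ = ε * (C * (N * (j + 1))) := by
        rw [hC]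
        push_cast
        field_simp
        ring
  have m3 : irrMeasure S3 ≤ ENNReal.ofReal ε := by
    refine (irrMeasure_trunc_le (w := fun m => 1 / m) (fun _ => by positivity) (4 * N) M
      (by positivity)).trans (ENNReal.ofReal_le_ofReal ?_)
    have h1 : ∑ m ∈ Finset.Icc 1 M, (1 : ℝ) / m * (2 / m) ≤ 4 :=
      (sum_inv_sq_Icc_le M).trans (by linarith [(by positivity : (0 : ℝ) ≤ 2 / M)])
    rw [div_le_iff₀ (by positivity)]
    calc _ ≤ ((4 * N : ℕ) : ℝ) * 4 := by gcongr
      _ = ε * (D * N) := by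
        rw [hD]
        push_cast
        field_simp
        ring
  have m4 : irrMeasure S4 ≤ ENNReal.ofReal ε := by
    refine (measure_le_sum_indicator_le (fun _ => zero_le_one) (fun i => ?_) (by positivity)
      (C := ((R : ℝ) + 1) ^ 2 * (4 * (ε / (8 * ((R : ℝ) + 1) ^ 2 * G) * (1 + Real.log Q)))) ?_).trans
      (ENNReal.ofReal_le_ofReal ?_)
    · refine measurableSet_of_digits (2 * i + 1) fun x y h => ?_
      rw [mem_ofPred_eq, mem_ofPred_eq, nextDen_congr h]
    · simp only [ENNReal.ofReal_one, one_mul]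
      exact sum_irrMeasure_nextDen_le hR hB _ _
    · rw [div_le_iff₀ (by positivity)]
      calc _ ≤ ((R : ℝ) + 1) ^ 2 * (4 * (ε / (8 * ((R : ℝ) + 1) ^ 2 * G) * (G * N))) := by gcongr
        _ = ε * (N / 2) := by
          field_simp
          ring
  have hcover : {x | ∑ i ∈ Finset.Ico N (2 * N), weight R B i x < 1 / (2 * (C + R)) / (j + 1)} ⊆
      irrUnitᶜ ∪ (S1 ∪ S2 ∪ (S3 ∪ S4)) := by
    intro x hx
    by_contra hcon
    simp only [mem_union, not_or, mem_compl_iff, not_not] at hcon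
    obtain ⟨hxi, ⟨h1, h2⟩, h3, h4⟩ := hcon
    rw [mem_ofPred_eq] at hx
    refine absurd hx (not_lt.2 ?_)
    have h1' : ∀ i ∈ Finset.range (4 * N), cfA x (i + 1) ≤ M := fun i hi => by
      by_contra! h
      exact h1 ⟨i, Finset.mem_range.1 hi, h.le⟩
    rw [hS2, mem_ofPred_eq, not_le] at h2
    rw [hS3, mem_ofPred_eq, not_le] at h3
    rw [hS4, mem_ofPred_eq, not_le] at h4
    refine le_sum_weight (D := D * N) (Q := Q) hN0 hR hC0 hxi ?_ ?_ (Nat.lt_floor_add_one _) ?_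
    · refine le_trans (le_of_eq ?_) h2.le
      rw [cfSum]
      push_cast
      refine Finset.sum_congr rfl fun i hi => ?_
      rw [sum_ite_le_eq (h1' i hi)]
      simp
    · refine le_trans (le_of_eq ?_) h3.le
      exact Finset.sum_congr rfl fun i hi => (sum_ite_le_eq (h1' i hi) _).symm
    · simpa only [indicator, mem_ofPred_eq] using h4.le
  calc _ ≤ irrMeasure (irrUnitᶜ ∪ (S1 ∪ S2 ∪ (S3 ∪ S4))) := measure_mono hcover
    _ ≤ 0 + ((ENNReal.ofReal ε + ENNReal.ofReal ε) + (ENNReal.ofReal ε + ENNReal.ofReal ε)) := by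
      refine (measure_union_le _ _).trans (add_le_add irrMeasure_compl.le ?_)
      refine (measure_union_le _ _).trans (add_le_add ?_ ?_)
      · exact (measure_union_le _ _).trans (add_le_add m1 m2)
      · exact (measure_union_le _ _).trans (add_le_add m3 m4)
    _ = ENNReal.ofReal (4 * ε) := by
      rw [zero_add, ← ENNReal.ofReal_add hε.le hε.le, ← ENNReal.ofReal_add (by linarith)
        (by linarith)]
      congr 1
      ring

lemma measurable_weight (R : ℕ) (B : Set ℕ) (i : ℕ) : Measurable (weight R B i) :=
  measurable_of_digits (2 * i + 1) fun _ _ h => weight_congr h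

lemma irrMeasure_summable_le {R : ℕ} {B : Set ℕ} {τ ε : ℝ} (hτ : 0 < τ) (hε : 0 < ε)
    (h : ∀ j : ℕ, irrMeasure {x | ∑ i ∈ Finset.Ico (2 ^ j) (2 * 2 ^ j), weight R B i x
      < τ / (j + 1)} ≤ ENNReal.ofReal (4 * ε)) :
    irrMeasure {x | Summable fun i => weight R B i x} ≤ ENNReal.ofReal (4 * ε) := by
  set F : ℕ → Set ℝ := fun j => {x | ∑ i ∈ Finset.Ico (2 ^ j) (2 * 2 ^ j), weight R B i x
    < τ / (j + 1)} with hF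
  set U : ℕ → Set ℝ := fun T => {x | ∀ J, ∑ i ∈ Finset.range J, weight R B i x ≤ T} with hU
  have hFm : ∀ j, MeasurableSet (F j) := fun j =>
    measurableSet_lt (Finset.measurable_sum _ fun i _ => measurable_weight R B i) measurable_const
  have hUm : ∀ T, MeasurableSet (U T) := fun T => by
    simp only [hU, ofPred_forall]
    exact MeasurableSet.iInter fun J =>
      measurableSet_le (Finset.measurable_sum _ fun i _ => measurable_weight R B i) measurable_const
  have hmono : Monotone U := fun T T' hT x hx J => (hx J).trans (by exact_mod_cast hT)
  have hsub : {x | Summable fun i => weight R B i x} ⊆ ⋃ T, U T := by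
    intro x hx
    obtain ⟨T, hT⟩ := exists_nat_ge (∑' i, weight R B i x)
    exact mem_iUnion.2 ⟨T, fun J =>
      (Summable.sum_le_tsum _ (fun i _ => weight_nonneg R B i x) hx).trans hT⟩
  refine (measure_mono hsub).trans ?_
  rw [hmono.measure_iUnion]
  refine iSup_le fun T => ?_
  rw [← ofReal_measureReal]
  apply ENNReal.ofReal_le_ofReal
  by_contra! hlt
  have hpt : ∀ J x, ∑ j ∈ Finset.range J, (U T \ F j).indicator (fun _ => τ / (j + 1)) x ≤ T := by
    intro J x
    by_cases hx : x ∈ U T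
    · have h1 : ∀ J, ∑ j ∈ Finset.range J, (U T \ F j).indicator (fun _ => τ / ((j : ℝ) + 1)) x ≤
          ∑ i ∈ Finset.Ico 1 (2 ^ J), weight R B i x := by
        intro J
        induction J with
        | zero => simp
        | succ J ih =>
          have h2 : 1 ≤ 2 ^ J := Nat.one_le_two_pow
          rw [Finset.sum_range_succ, pow_succ, mul_comm (2 ^ J) 2,
            ← Finset.sum_Ico_consecutive _ h2 (by omega : 2 ^ J ≤ 2 * 2 ^ J)]
          refine add_le_add ih ?_
          by_cases hxF : x ∈ F J
          · rw [indicator_of_notMem fun h => h.2 hxF]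
            exact Finset.sum_nonneg fun i _ => weight_nonneg R B i x
          · rw [indicator_of_mem (show x ∈ U T \ F J from ⟨hx, hxF⟩)]
            exact not_lt.1 hxF
      refine (h1 J).trans (le_trans ?_ (hx (2 ^ J)))
      exact Finset.sum_le_sum_of_subset_of_nonneg
        (fun i hi => Finset.mem_range.2 (Finset.mem_Ico.1 hi).2) fun i _ _ => weight_nonneg R B i x
    · rw [Finset.sum_eq_zero fun j _ => indicator_of_notMem (fun h => hx h.1) _]
      exact Nat.cast_nonneg T
  have hbound : ∀ J : ℕ, (irrMeasure.real (U T) - 4 * ε) * τ *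
      ∑ j ∈ Finset.range J, 1 / ((j : ℝ) + 1) ≤ T := by
    intro J
    have hi : ∀ j ∈ Finset.range J, Integrable
        ((U T \ F j).indicator fun _ => τ / ((j : ℝ) + 1)) irrMeasure := fun j _ =>
      (integrable_const _).indicator ((hUm T).diff (hFm j))
    have h1 := integral_mono (μ := irrMeasure) (integrable_finsetSum _ hi)
      (integrable_const (T : ℝ)) (fun x => by simpa only [Finset.sum_apply] using hpt J x)
    rw [integral_finsetSum _ hi, integral_const, probReal_univ, one_smul] at h1
    refine le_trans ?_ h1
    rw [Finset.mul_sum]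
    refine Finset.sum_le_sum fun j _ => ?_
    rw [integral_indicator_const _ ((hUm T).diff (hFm j)), smul_eq_mul]
    have h2 : irrMeasure.real (F j) ≤ 4 * ε := by
      rw [measureReal_def]
      exact ENNReal.toReal_le_of_le_ofReal (by positivity) (h j)
    have h3 : irrMeasure.real (U T) - irrMeasure.real (F j) ≤ irrMeasure.real (U T \ F j) :=
      le_measureReal_sdiff
    rw [mul_assoc, mul_one_div]
    gcongr
    linarith
  have hd : 0 < (irrMeasure.real (U T) - 4 * ε) * τ := mul_pos (by linarith) hτ
  have hlim := Real.tendsto_sum_range_one_div_nat_succ_atTop.const_mul_atTop hd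
  obtain ⟨J, hJ⟩ := (hlim.eventually_gt_atTop (T : ℝ)).exists
  exact absurd (hbound J) (not_le.2 hJ)

lemma le_norm_nsmul_of_coprime {β : UnitAddCircle} (hβ : β ≠ 0) (hfin : IsOfFinAddOrder β)
    {R q : ℕ} (hR : 0 < R) (hd : addOrderOf β ∣ R) (hq : q.Coprime R) :
    1 / (R : ℝ) ≤ ‖q • β‖ := by
  have hne : q • β ≠ 0 := by
    intro h
    have h1 := addOrderOf_dvd_of_nsmul_eq_zero h
    have h2 : addOrderOf β = 1 := Nat.eq_one_of_dvd_coprimes hq h1 hd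
    exact hβ (AddMonoid.addOrderOf_eq_one_iff.1 h2)
  have h := AddCircle.le_add_order_smul_norm_of_isOfFinAddOrder (hfin.nsmul (n := q)) hne
  have hle : addOrderOf (q • β) ≤ R :=
    Nat.le_of_dvd hR ((addOrderOf_dvd_iff_nsmul_eq_zero.2 (by
      rw [← mul_nsmul', mul_comm, mul_nsmul', addOrderOf_nsmul_eq_zero, nsmul_zero])).trans hd)
  rw [div_le_iff₀ (by exact_mod_cast hR), mul_comm]
  rw [nsmul_eq_mul] at h
  refine h.trans ?_
  gcongr

/-- For almost every `x` there are infinitely many even `n` such that `a_{n+1}` dominates the sum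
of the previous partial quotients and `q_n` moves a given finite family of nonzero points of the
circle away from zero. -/
lemma ae_exists_large_cfA {ι : Type*} [Finite ι] {β : ι → UnitAddCircle} (hβ : ∀ j, β j ≠ 0) :
    ∀ᵐ x ∂irrMeasure, ∃ c > 0, ∀ K M : ℕ, ∃ n ≥ M, 0 < n ∧ Even n ∧
      (∀ j, c ≤ ‖cvDen x (n + 1) • β j‖) ∧ K * cfSum n x ≤ cfA x (n + 1) := by
  classical
  have := Fintype.ofFinite ι
  set R : ℕ := ∏ j, if IsOfFinAddOrder (β j) then addOrderOf (β j) else 1 with hR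
  have hR0 : 0 < R := Finset.prod_pos fun j _ => by
    split_ifs with h
    · exact h.addOrderOf_pos
    · exact one_pos
  have hdvd : ∀ j, IsOfFinAddOrder (β j) → addOrderOf (β j) ∣ R := fun j hj => by
    have := Finset.dvd_prod_of_mem
      (fun j => if IsOfFinAddOrder (β j) then addOrderOf (β j) else 1) (Finset.mem_univ j)
    simpa only [if_pos hj] using this
  have hsp : ∀ l : ℕ, ∃ c > 0, irrMeasure {x | Summable fun i => weight R
      {q | ∃ j : {j // ¬ IsOfFinAddOrder (β j)}, ‖q • β j‖ < c} i x} ≤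
        ENNReal.ofReal (4 * (1 / (l + 1))) := fun l => by
    obtain ⟨η, hη, τ, hτ, h⟩ := exists_block_bound hR0
      (by positivity : (0 : ℝ) < 1 / ((l : ℝ) + 1))
    obtain ⟨c, hc, hs⟩ := exists_logSparse_exists
      (β := fun j : {j // ¬ IsOfFinAddOrder (β j)} => β j) (fun j => j.2) hη
    exact ⟨c, hc, irrMeasure_summable_le hτ (by positivity) (h _ hs)⟩
  choose c hc hcs using hsp
  have hex : ∀ᵐ x ∂irrMeasure, ∃ l, ¬ Summable fun i => weight R
      {q | ∃ j : {j // ¬ IsOfFinAddOrder (β j)}, ‖q • β j‖ < c l} i x := by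
    rw [ae_iff]
    simp only [not_exists, not_not]
    refine le_antisymm (ge_of_tendsto' (x := atTop)
      (f := fun l : ℕ => ENNReal.ofReal (4 * (1 / (l + 1)))) ?_ fun l => ?_) zero_le
    · have h := (tendsto_one_div_add_atTop_nhds_zero_nat (𝕜 := ℝ)).const_mul 4
      rw [mul_zero] at h
      simpa using ENNReal.tendsto_ofReal h
    · exact (measure_mono (ofPred_subset_ofPred.2 fun x hx => hx l)).trans (hcs l)
  have hbc : ∀ᵐ x ∂irrMeasure, ∀ l K : ℕ, _ := ae_all_iff.2 fun l => ae_all_iff.2 fun K =>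
    ae_frequently_large hR0 (Nat.succ_pos K)
      {q | ∃ j : {j // ¬ IsOfFinAddOrder (β j)}, ‖q • β j‖ < c l}
  filter_upwards [hex, hbc, ae_mem_irrUnit] with x hx hbx hxi
  obtain ⟨l, hl⟩ := hx
  refine ⟨min (c l) (1 / R), lt_min (hc l) (by positivity), fun K M => ?_⟩
  obtain ⟨i, hi, h1, h2, h3⟩ := (frequently_atTop.1 (hbx l K hl)) M
  refine ⟨2 * i + 2, by omega, by omega, ⟨i + 1, by ring⟩, fun j => ?_, ?_⟩
  · rw [show 2 * i + 2 + 1 = 2 * i + 3 from rfl, cvDen_eq_nextDen h1]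
    by_cases hj : IsOfFinAddOrder (β j)
    · exact (min_le_right _ _).trans
        (le_norm_nsmul_of_coprime (hβ j) hj hR0 (hdvd j hj) (coprime_nextDen hR0 hxi))
    · refine (min_le_left _ _).trans ?_
      by_contra! hlt
      exact h2 ⟨⟨j, hj⟩, hlt⟩
  · have h4 : cfSum (2 * i + 2) x ≤ cfSum (2 * i + 1) x + R := by
      rw [cfSum, Finset.sum_range_succ, h1]
      exact Nat.add_le_add_left (coprimeShift_le hR0 _ _) _
    calc K * cfSum (2 * i + 2) x ≤ (K + 1) * (cfSum (2 * i + 1) x + R) :=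
          Nat.mul_le_mul K.le_succ h4
      _ ≤ _ := h3

lemma iota_coe (x : ℝ) : iota (x : UnitAddCircle) = Int.fract x := by
  rw [iota, AddCircle.coe_equivIco_mk_apply, div_one, mul_one]

lemma coe_iota (z : UnitAddCircle) : ((iota z : ℝ) : UnitAddCircle) = z :=
  (AddCircle.equivIco 1 0).symm_apply_apply z

lemma iota_mem (z : UnitAddCircle) : iota z ∈ Ico (0 : ℝ) 1 := by
  simpa [iota] using (AddCircle.equivIco 1 0 z).2

lemma quasiMeasurePreserving_iota :
    Measure.QuasiMeasurePreserving iota (volume : Measure UnitAddCircle) irrMeasure := by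
  have hm : Measurable iota :=
    measurable_subtype_coe.comp (AddCircle.measurableEquivIco 1 0).measurable
  refine ⟨hm, Measure.AbsolutelyContinuous.mk fun s hs h0 => ?_⟩
  rw [irrMeasure_apply] at h0
  have hQ : volume (range ((↑) : ℚ → ℝ)) = 0 := (countable_range _).measure_zero volume
  rw [Measure.map_apply hm hs, ← (UnitAddCircle.measurePreserving_mk 0).measure_preimage
    (hm hs).nullMeasurableSet, Measure.restrict_apply' measurableSet_Ioc]
  refine measure_mono_null (t := s ∩ irrUnit ∪ range ((↑) : ℚ → ℝ)) (fun x hx => ?_)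
    (measure_union_null h0 hQ)
  by_cases hxi : Irrational x
  · have hlt : x < 1 := lt_of_le_of_ne (by simpa using hx.2.2) hxi.ne_one
    have hs' : Int.fract x ∈ s := by
      have h := hx.1
      simp only [mem_preimage] at h
      rwa [show ((QuotientAddGroup.mk x : UnitAddCircle)) = (x : UnitAddCircle) from rfl,
        iota_coe] at h
    rw [Int.fract_eq_self.2 ⟨hx.2.1.le, hlt⟩] at hs'
    exact Or.inl ⟨hs', hxi, hx.2.1, hlt⟩
  · exact Or.inr (not_not.1 hxi)

lemma ite_iota_sub_iota (x g : UnitAddCircle) :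
    (if iota x < iota g then (1 : ℝ) else 0) - iota g = iota (x - g) - iota x := by
  have hx := iota_mem x
  have hg := iota_mem g
  have h : iota (x - g) = Int.fract (iota x - iota g) := by
    rw [← iota_coe, AddCircle.coe_sub, coe_iota, coe_iota]
  rw [h]
  split_ifs with hlt
  · rw [show iota x - iota g = (iota x - iota g + 1) - 1 by ring, Int.fract_sub_one,
      Int.fract_eq_self.2 ⟨by linarith [hx.1, hg.2], by linarith⟩]
    ring
  · rw [Int.fract_eq_self.2 ⟨by linarith [not_lt.1 hlt], by linarith [hx.2, hg.1]⟩]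
    ring

lemma sawtooth_add_sum_indicator_eq {ν : ℕ} (H : Fin ν → ℝ) (γ : Fin ν → UnitAddCircle)
    (x : UnitAddCircle) :
    (∑ i, H i) * (iota x - 1 / 2)
      + ∑ i, H i * ((if iota x < iota (γ i) then (1 : ℝ) else 0) - iota (γ i))
      = ∑ i, H i * (iota (x - γ i) - 1 / 2) := by
  rw [Finset.sum_mul, ← Finset.sum_add_distrib]
  refine Finset.sum_congr rfl fun i _ => ?_
  rw [ite_iota_sub_iota]
  ring

lemma iota_coe_add (y : ℝ) (z : UnitAddCircle) :
    iota ((y : UnitAddCircle) + z) = Int.fract (y + iota z) := by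
  rw [← iota_coe, AddCircle.coe_add, coe_iota]

lemma integral_ite_iota_sub (z g : UnitAddCircle) (c : ℝ) :
    (∫ y in (0:ℝ)..c, (if iota (toCircle y + z) ≤ iota g then (1 : ℝ) else 0)) - c * iota g
      = (∫ y in (0:ℝ)..c, Int.fract (y + iota (z - g)))
        - ∫ y in (0:ℝ)..c, Int.fract (y + iota z) := by
  have hcount : {y : ℝ | iota (toCircle y + z) = iota g}.Countable := by
    refine (countable_range fun m : ℤ => (m : ℝ) + (iota g - iota z)).mono fun y hy => ?_
    rw [mem_ofPred_eq, toCircle, iota_coe_add, Int.fract] at hy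
    exact ⟨⌊y + iota z⌋, by simp only; linarith⟩
  have hae : ∀ᵐ y : ℝ, y ∈ uIoc 0 c →
      (if iota (toCircle y + z) ≤ iota g then (1 : ℝ) else 0)
        = Int.fract (y + iota (z - g)) - Int.fract (y + iota z) + iota g := by
    filter_upwards [hcount.ae_notMem volume] with y hy _
    have h := ite_iota_sub_iota (toCircle y + z) g
    rw [add_sub_assoc] at h
    rw [← iota_coe_add, ← iota_coe_add, ← toCircle]
    have hiff : iota (toCircle y + z) ≤ iota g ↔ iota (toCircle y + z) < iota g :=
      ⟨fun h => lt_of_le_of_ne h hy, le_of_lt⟩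
    simp only [hiff]
    linarith
  have h1 := intervalIntegrable_fract (iota (z - g)) 0 c
  have h2 := intervalIntegrable_fract (iota z) 0 c
  rw [intervalIntegral.integral_congr_ae hae, intervalIntegral.integral_add (h1.sub h2) (by simp),
    intervalIntegral.integral_sub h1 h2, intervalIntegral.integral_const, sub_zero, smul_eq_mul]
  ring

lemma profile_eq {ν : ℕ} (H : Fin ν → ℝ) (z : UnitAddCircle) (g : Fin ν → UnitAddCircle) (c : ℝ) :
    (∑ i, H i) * ((∫ y in (0:ℝ)..c, iota (toCircle y + z)) - c / 2)
      + ∑ i, H i * ((∫ y in (0:ℝ)..c,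
          (if iota (toCircle y + z) ≤ iota (g i) then (1 : ℝ) else 0)) - c * iota (g i))
      = ∑ i, H i * ((∫ y in (0:ℝ)..c, Int.fract (y + iota (z - g i))) - c / 2) := by
  rw [Finset.sum_mul, ← Finset.sum_add_distrib]
  refine Finset.sum_congr rfl fun i _ => ?_
  rw [integral_ite_iota_sub]
  simp only [toCircle, iota_coe_add]
  ring

lemma birkhoff_eq {ν : ℕ} (H : Fin ν → ℝ) (γ : Fin ν → UnitAddCircle) (α x₀ : UnitAddCircle)
    (N : ℕ) :
    birkhoff (fun x => ∑ i, H i * (iota (x - γ i) - 1 / 2)) α x₀ N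
      = ∑ i, H i * ∑ k ∈ Finset.range N, (Int.fract (iota (x₀ - γ i) + k * iota α) - 1 / 2) := by
  rw [birkhoff, Finset.sum_comm]
  refine Finset.sum_congr rfl fun i _ => ?_
  rw [Finset.mul_sum]
  refine Finset.sum_congr rfl fun k _ => ?_
  rw [← iota_coe, AddCircle.coe_add, coe_iota, ← nsmul_eq_mul, AddCircle.coe_nsmul, coe_iota]
  congr 4
  abel

lemma abs_sum_sawtooth_iota_sub_integral_le {x : ℝ} (hx : x ∈ irrUnit) {n : ℕ} (hn : Even n)
    (z w : UnitAddCircle) {c : ℝ} (hc : c ∈ Icc (0 : ℝ) 1) :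
    |(∑ k ∈ Finset.range (⌊c * (cfA x (n + 1) : ℝ)⌋₊ * cvDen x (n + 1)),
        (Int.fract (iota z + k * x) - 1 / 2)) / cfA x (n + 1)
      - ((∫ y in (0:ℝ)..c, Int.fract (y + iota w)) - c / 2)|
      ≤ 3 * ‖cvDen x (n + 1) • z - w‖ + 13 / cfA x (n + 1) := by
  have hq := cvDen_pos hx n
  have hq' : (0 : ℝ) < cvDen x (n + 1) := by exact_mod_cast hq
  have ha := one_le_cfA hx n
  have ha' : (1 : ℝ) ≤ cfA x (n + 1) := by exact_mod_cast ha
  have hg := (gaussIter_mem hx n).2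
  have hg' := (gaussIter_mem hx (n + 1)).2
  have hd := one_div_gaussIter hx n
  have hle : (cvDen x n : ℝ) ≤ cvDen x (n + 1) := by exact_mod_cast cvDen_le_succ hx n
  have h0 : (0 : ℝ) ≤ cvDen x n := Nat.cast_nonneg _
  have hθ := cvDen_mul_sub_cvNum hx n
  rw [hn.neg_one_pow, one_mul] at hθ
  have hcop : (cvNum x (n + 1)).Coprime (cvDen x (n + 1)) := by
    rw [← Nat.isCoprime_iff_coprime]
    refine ⟨-cvDen x n, cvNum x n, ?_⟩
    have h := cvNum_mul_cvDen x n
    rw [hn.neg_one_pow] at h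
    linarith
  set t := gaussIter x n
  set q := (cvDen x (n + 1) : ℝ)
  set r := (cvDen x n : ℝ)
  have hden : 0 < q + t * r := by nlinarith [mul_nonneg hg.1.le h0]
  have ht : 1 = (cfA x (n + 1) + gaussIter x (n + 1)) * t := by
    rw [← hd, one_div_mul_cancel hg.1.ne']
  refine abs_sum_sawtooth_sub_integral_le (q := cvDen x (n + 1)) (iota z) x hq hcop ha
    (θ := t / (q + t * r)) (m := round (q * iota z - iota w)) (by linarith) ?_ ?_ ?_ hc
  · rw [div_le_iff₀ (by positivity), ← mul_div_assoc, div_mul_eq_mul_div, le_div_iff₀ hden, one_mul]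
    nlinarith [mul_nonneg (mul_nonneg hg.1.le hq'.le) (sub_nonneg.2 hg'.2.le),
      mul_nonneg hg.1.le (sub_nonneg.2 hle)]
  · rw [← mul_div_assoc, div_le_div_iff₀ hden (by positivity), one_mul]
    nlinarith [mul_nonneg (mul_nonneg hg.1.le hq'.le) hg'.1.le, mul_nonneg hg.1.le h0]
  · have h : cvDen x (n + 1) • z - w = ((q * iota z - iota w : ℝ) : UnitAddCircle) := by
      rw [AddCircle.coe_sub, coe_iota, ← nsmul_eq_mul, AddCircle.coe_nsmul, coe_iota]
    rw [h, UnitAddCircle.norm_eq, sub_right_comm]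

/-- Along a suitable subsequence of the `n` provided by `h`, the points `q_n • z` converge for
finitely many prescribed `z`. -/
lemma exists_strictMono_tendsto {ι : Type*} {κ : Type*} [Fintype κ] {x : ℝ}
    {β : ι → UnitAddCircle} {c : ℝ}
    (h : ∀ K M : ℕ, ∃ n ≥ M, 0 < n ∧ Even n ∧
      (∀ j, c ≤ ‖cvDen x (n + 1) • β j‖) ∧ K * cfSum n x ≤ cfA x (n + 1))
    (z : κ → UnitAddCircle) :
    ∃ n : ℕ → ℕ, StrictMono n ∧ (∀ l, 0 < n l) ∧ (∀ l, Even (n l)) ∧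
      (∀ l j, c ≤ ‖cvDen x (n l + 1) • β j‖) ∧ (∀ l, l * cfSum (n l) x ≤ cfA x (n l + 1)) ∧
      ∃ w : κ → UnitAddCircle,
        ∀ k, Tendsto (fun l => cvDen x (n l + 1) • z k) atTop (𝓝 (w k)) := by
  choose g hg hg0 hgE hgβ hgK using h
  let m : ℕ → ℕ := fun l => Nat.rec (g 0 0) (fun l r => g (l + 1) (r + 1)) l
  have hm : ∀ l, ∃ M, m l = g l M := fun l => by
    cases l with
    | zero => exact ⟨0, rfl⟩
    | succ l => exact ⟨m l + 1, rfl⟩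
  have hmono : StrictMono m := strictMono_nat_of_lt_succ fun l =>
    Nat.lt_of_succ_le (hg (l + 1) (m l + 1))
  obtain ⟨w, φ, hφ, hw⟩ :=
    CompactSpace.tendsto_subseq (fun l => fun k => cvDen x (m l + 1) • z k)
  refine ⟨m ∘ φ, hmono.comp hφ, fun l => ?_, fun l => ?_, fun l => ?_, fun l => ?_, w,
    fun k => (tendsto_pi_nhds.1 hw) k⟩
  all_goals obtain ⟨M, hM⟩ := hm (φ l)
  all_goals simp only [Function.comp_apply, hM]
  · exact hg0 _ _
  · exact hgE _ _
  · exact hgβ _ _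
  · exact (Nat.mul_le_mul_right _ (hφ.id_le l)).trans (hgK _ _)

lemma cast_cfSum (n : ℕ) (x : ℝ) : (cfSum n x : ℝ) = ∑ i ∈ Finset.Icc 1 n, (cfA x i : ℝ) := by
  rw [cfSum, Nat.cast_sum, Finset.range_eq_Ico,
    Finset.sum_Ico_add' (fun i => (cfA x i : ℝ)) 0 n 1, zero_add]
  rfl

lemma le_norm_of_tendsto {q : ℕ → ℕ} {β w : UnitAddCircle} {c : ℝ}
    (h : ∀ l, c ≤ ‖q l • β‖) (hw : Tendsto (fun l => q l • β) atTop (𝓝 w)) : c ≤ ‖w‖ :=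
  ge_of_tendsto' hw.norm h

/-- Main lemma: for `f` a linear combination of the sawtooth and centered indicators
with distinct discontinuities `γ i`, for a.e. `α` and every `x₀` there is a sequence
`(n_ℓ)` along which the normalized Birkhoff sums `S_{⌊c a_{n_ℓ+1}⌋ q_{n_ℓ}} / a_{n_ℓ+1}`
converge uniformly in `c ∈ [0,1]` to an explicit profile. -/
theorem main_lemma_profile_convergence (ν : ℕ) (hν : 0 < ν) (H : Fin ν → ℝ)
    (γ : Fin ν → UnitAddCircle) (hγ : Function.Injective γ)
    (f : UnitAddCircle → ℝ)
    (hf : f = fun x => (∑ i, H i) * (iota x - 1/2)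
      + ∑ i, H i * ((if iota x < iota (γ i) then (1 : ℝ) else 0) - iota (γ i))) :
    ∀ᵐ α ∂(volume : Measure UnitAddCircle), ∀ x₀ : UnitAddCircle,
      ∃ n : ℕ → ℕ, StrictMono n ∧ (∀ ℓ, 0 < n ℓ) ∧
        Filter.Tendsto
          (fun ℓ => (∑ i ∈ Finset.Icc 1 (n ℓ), (cfA (iota α) i : ℝ)) / (cfA (iota α) (n ℓ + 1)))
          Filter.atTop (nhds 0) ∧
        ∃ (xbar : UnitAddCircle) (gbar : Fin ν → UnitAddCircle),
          Filter.Tendsto (fun ℓ => (cfQ (iota α) (n ℓ)) • x₀) Filter.atTop (nhds xbar) ∧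
          (∀ i, Filter.Tendsto (fun ℓ => (cfQ (iota α) (n ℓ)) • γ i)
            Filter.atTop (nhds (gbar i))) ∧
          (∀ i, i ≠ ⟨0, hν⟩ → gbar i ≠ gbar ⟨0, hν⟩) ∧
          (γ ⟨0, hν⟩ ≠ 0 → gbar ⟨0, hν⟩ ≠ 0) ∧
          Filter.Tendsto (fun ℓ => ⨆ c : Set.Icc (0:ℝ) 1,
            |birkhoff f α x₀ (⌊(c : ℝ) * (cfA (iota α) (n ℓ + 1) : ℝ)⌋₊ * cfQ (iota α) (n ℓ))
                / (cfA (iota α) (n ℓ + 1) : ℝ)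
              - ((∑ i, H i) * ((∫ y in (0:ℝ)..(c : ℝ), iota (toCircle y + xbar)) - (c : ℝ) / 2)
                + ∑ i, H i * ((∫ y in (0:ℝ)..(c : ℝ),
                    (if iota (toCircle y + xbar) ≤ iota (gbar i) then (1 : ℝ) else 0))
                  - (c : ℝ) * iota (gbar i)))|)
            Filter.atTop (nhds 0) := by
  subst hf
  set o : Fin ν := ⟨0, hν⟩
  set β : {i : Option (Fin ν) // i.elim (γ o) (fun i => γ i - γ o) ≠ 0} → UnitAddCircle :=
    fun i => i.1.elim (γ o) fun i => γ i - γ o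
  have hae := quasiMeasurePreserving_iota.ae
    (ae_mem_irrUnit.and (ae_exists_large_cfA (β := β) fun j => j.2))
  filter_upwards [hae] with α hα x₀
  obtain ⟨hx, c, hc, hex⟩ := hα
  obtain ⟨n, hmono, hpos, heven, hnorm, hsum, w, hw⟩ :=
    exists_strictMono_tendsto hex (fun k : Option (Fin ν) => k.elim x₀ γ)
  have hw0 : Tendsto (fun l => cvDen (iota α) (n l + 1) • x₀) atTop (𝓝 (w none)) := hw none
  have hwi : ∀ i, Tendsto (fun l => cvDen (iota α) (n l + 1) • γ i) atTop (𝓝 (w (some i))) :=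
    fun i => hw (some i)
  have ha : ∀ l, (0 : ℝ) < cfA (iota α) (n l + 1) := fun l => by
    exact_mod_cast one_le_cfA hx (n l)
  have hone : ∀ l, (1 : ℝ) ≤ cfSum (n l) (iota α) := fun l => by
    have h := Finset.single_le_sum (f := fun m => cfA (iota α) (m + 1)) (fun _ _ => Nat.zero_le _)
      (Finset.mem_range.2 (hpos l))
    exact_mod_cast (one_le_cfA hx 0).trans h
  have hsum' : ∀ l : ℕ, (l : ℝ) * cfSum (n l) (iota α) ≤ cfA (iota α) (n l + 1) := fun l => by
    exact_mod_cast hsum l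
  have htop : Tendsto (fun l => (cfA (iota α) (n l + 1) : ℝ)) atTop atTop :=
    tendsto_atTop_mono (fun l => (le_mul_of_one_le_right (Nat.cast_nonneg l) (hone l)).trans
      (hsum' l)) tendsto_natCast_atTop_atTop
  refine ⟨n, hmono, hpos, ?_, w none, fun i => w (some i), ?_⟩
  · simp only [← cast_cfSum]
    refine squeeze_zero' (Eventually.of_forall fun l => by positivity) ?_
      tendsto_one_div_atTop_nhds_zero_nat
    filter_upwards [eventually_gt_atTop 0] with l hl
    rw [div_le_div_iff₀ (ha l) (by exact_mod_cast hl), one_mul, mul_comm]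
    exact hsum' l
  simp only [cfQ_eq_cvDen]
  refine ⟨hw0, hwi, fun i hi => ?_, fun h0 => ?_, ?_⟩
  · have hne : γ i - γ o ≠ 0 := sub_ne_zero.2 (hγ.ne hi)
    have ht := (hwi i).sub (hwi o)
    simp only [← smul_sub] at ht
    have h := le_norm_of_tendsto (fun l => hnorm l ⟨some i, hne⟩) ht
    exact sub_ne_zero.1 (norm_pos_iff.1 (hc.trans_le h))
  · have h := le_norm_of_tendsto (fun l => hnorm l ⟨none, h0⟩) (hwi o)
    exact norm_pos_iff.1 (hc.trans_le h)
  simp only [sawtooth_add_sum_indicator_eq, birkhoff_eq, profile_eq]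
  have hlim : Tendsto (fun l => ∑ i, |H i| *
      (3 * ‖cvDen (iota α) (n l + 1) • (x₀ - γ i) - (w none - w (some i))‖
        + 13 / cfA (iota α) (n l + 1))) atTop (𝓝 0) := by
    rw [show (0 : ℝ) = ∑ i, |H i| * (3 * 0 + 0) by simp]
    refine tendsto_finsetSum _ fun i _ => Tendsto.const_mul _ (Tendsto.add ?_ ?_)
    · refine Tendsto.const_mul _ ?_
      have h := (((hw0.sub (hwi i)).sub_const (w none - w (some i)))).norm
      simpa only [← smul_sub, sub_self, norm_zero] using h
    · exact htop.const_div_atTop 13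
  refine squeeze_zero (fun l => Real.iSup_nonneg fun _ => abs_nonneg _) (fun l => ?_) hlim
  refine Real.iSup_le (fun c => ?_) (Finset.sum_nonneg fun i _ => by positivity)
  rw [Finset.sum_div, ← Finset.sum_sub_distrib]
  refine (Finset.abs_sum_le_sum_abs _ _).trans (Finset.sum_le_sum fun i _ => ?_)
  rw [mul_div_assoc, ← mul_sub, abs_mul]
  exact mul_le_mul_of_nonneg_left
    (abs_sum_sawtooth_iota_sub_integral_le hx (heven l) _ _ c.2) (abs_nonneg _)
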